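/- For every nonempty primary basic semialgebraic set V ⊆ ℝ^m defined over ℤ, there exist an integer n ≥ 3 and a realizable rank-3 chirotope χ on n elements (equivalently, a realizable oriented matroid of rank 3 on n elements) such that V is stably equivalent to the realization space ℛ(χ). -/

import Mathlib

noncomputable section

/-- A primary basic semialgebraic set in `ℝ^m` defined over `ℤ`: the solution set of finitely
many polynomial equalities and *strict* polynomial inequalities with integer coefficients. -/
def IsPrimaryBasicSemialgebraicZ {m : ℕ} (S : Set (Fin m → ℝ)) : Prop :=
  ∃ (k l : ℕ) (f : Fin k → MvPolynomial (Fin m) ℤ) (g : Fin l → MvPolynomial (Fin m) ℤ),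
    S = {x : Fin m → ℝ |
      (∀ i, MvPolynomial.aeval x (f i) = (0 : ℝ)) ∧
      (∀ j, (0 : ℝ) < MvPolynomial.aeval x (g j))}

/-- `S ⊆ ℝ^d` is a stable projection of `T ⊆ ℝ^{d+d'}`: the coordinate projection maps `T`
onto `S`, and over each `x ∈ S` the fiber of `T` is a nonempty set given by linear equalities
and strict linear inequalities in the fiber variables, whose coefficients depend polynomially
on `x` (i.e. the relative interior of a nonempty polyhedron depending polynomially on `x`). -/
def IsStableProjection {d d' : ℕ} (S : Set (Fin d → ℝ)) (T : Set (Fin (d + d') → ℝ)) : Prop :=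
  ∃ (k l : ℕ) (A : Fin k → Fin d' → MvPolynomial (Fin d) ℝ) (b : Fin k → MvPolynomial (Fin d) ℝ)
    (C : Fin l → Fin d' → MvPolynomial (Fin d) ℝ) (c : Fin l → MvPolynomial (Fin d) ℝ),
    (∀ x ∈ S, ∃ y : Fin d' → ℝ, Fin.append x y ∈ T) ∧
    ∀ (x : Fin d → ℝ) (y : Fin d' → ℝ),
      Fin.append x y ∈ T ↔
        x ∈ S ∧
        (∀ i, (∑ j, MvPolynomial.eval x (A i j) * y j) + MvPolynomial.eval x (b i) = 0) ∧
        (∀ i, 0 < (∑ j, MvPolynomial.eval x (C i j) * y j) + MvPolynomial.eval x (c i))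

/-- `f` is coordinatewise a rational function on `S` (denominators nonvanishing on `S`). -/
def IsRationalMapOn {d e : ℕ} (S : Set (Fin d → ℝ)) (f : (Fin d → ℝ) → Fin e → ℝ) : Prop :=
  ∀ i : Fin e, ∃ p q : MvPolynomial (Fin d) ℝ, ∀ x ∈ S,
    MvPolynomial.eval x q ≠ 0 ∧ f x i = MvPolynomial.eval x p / MvPolynomial.eval x q

/-- `S` and `T` are rationally equivalent: there are mutually inverse bijections between them
which are coordinatewise rational (hence in particular a homeomorphism). -/
def RationallyEquivalent {d e : ℕ} (S : Set (Fin d → ℝ)) (T : Set (Fin e → ℝ)) : Prop :=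
  ∃ (f : (Fin d → ℝ) → Fin e → ℝ) (g : (Fin e → ℝ) → Fin d → ℝ),
    IsRationalMapOn S f ∧ IsRationalMapOn T g ∧
    (∀ x ∈ S, f x ∈ T) ∧ (∀ y ∈ T, g y ∈ S) ∧
    (∀ x ∈ S, g (f x) = x) ∧ (∀ y ∈ T, f (g y) = y)

/-- One generating step of stable equivalence: a stable projection (in either direction,
symmetry being supplied by the generated equivalence) or a rational equivalence. -/
def StableStep (X Y : Σ d : ℕ, Set (Fin d → ℝ)) : Prop :=
  (∃ (d' : ℕ) (T : Set (Fin (X.1 + d') → ℝ)),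
      Y = ⟨X.1 + d', T⟩ ∧ IsStableProjection X.2 T) ∨
  RationallyEquivalent X.2 Y.2

/-- Stable equivalence: the equivalence relation generated by stable projections and
rational equivalences. -/
def StablyEquivalent (X Y : Σ d : ℕ, Set (Fin d → ℝ)) : Prop :=
  Relation.EqvGen StableStep X Y

/-- The index of the `c`-th coordinate of the `p`-th point in the flattening
`(ℝ^d)^n ≃ ℝ^{d·n}`. -/
def flatIdx {n d : ℕ} (p : Fin n) (c : Fin d) : Fin (d * n) :=
  ⟨d * p.1 + c.1, by
    have h1 : d * (p.1 + 1) ≤ d * n := Nat.mul_le_mul le_rfl p.2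
    have h2 : d * (p.1 + 1) = d * p.1 + d := by ring
    have h3 := c.2
    omega⟩

/-- Flatten a set of point configurations `(ℝ^d)^n` into a subset of `ℝ^{d·n}`. -/
def flat {n d : ℕ} (R : Set (Fin n → Fin d → ℝ)) : Set (Fin (d * n) → ℝ) :=
  {x | (fun (p : Fin n) (c : Fin d) => x (flatIdx p c)) ∈ R}

/-- The determinant of three vectors in `ℝ³`. -/
def det3 (u v w : Fin 3 → ℝ) : ℝ :=
  u 0 * (v 1 * w 2 - v 2 * w 1) - u 1 * (v 0 * w 2 - v 2 * w 0) +
    u 2 * (v 0 * w 1 - v 1 * w 0)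

/-- A map on triples is alternating: swapping two adjacent arguments changes the sign. -/
def IsAlternating3 {n : ℕ} (χ : Fin n → Fin n → Fin n → ℝ) : Prop :=
  ∀ i j k : Fin n, χ j i k = -χ i j k ∧ χ i k j = -χ i j k

/-- `v` is a realization of the uniform chirotope `χ`: for all distinct `i, j, k`,
the sign of `det(v i, v j, v k)` is `χ i j k`. -/
def IsRealizationOfUniform {n : ℕ} (χ : Fin n → Fin n → Fin n → ℝ)
    (v : Fin n → Fin 3 → ℝ) : Prop :=
  ∀ i j k : Fin n, i ≠ j → i ≠ k → j ≠ k →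
    Real.sign (det3 (v i) (v j) (v k)) = χ i j k

/-- A realizable uniform rank-3 chirotope on `n` elements. -/
def IsRealizableUniformChirotope {n : ℕ} (χ : Fin n → Fin n → Fin n → ℝ) : Prop :=
  IsAlternating3 χ ∧
  (∀ i j k : Fin n, i ≠ j → i ≠ k → j ≠ k → χ i j k = 1 ∨ χ i j k = -1) ∧
  ∃ v, IsRealizationOfUniform χ v

/-- The normalized realization space of a uniform rank-3 chirotope `χ`
(normalized so that the first three vectors are the standard basis of `ℝ³`,
which presupposes `χ 1 2 3 = +1`). -/
def uniformChirotopeRealizationSpace {n : ℕ} (hn : 3 ≤ n)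
    (χ : Fin n → Fin n → Fin n → ℝ) : Set (Fin n → Fin 3 → ℝ) :=
  {v | v ⟨0, by omega⟩ = ![1, 0, 0] ∧ v ⟨1, by omega⟩ = ![0, 1, 0] ∧
       v ⟨2, by omega⟩ = ![0, 0, 1] ∧ IsRealizationOfUniform χ v}

/-- `v` is a realization of the (not necessarily uniform) rank-3 chirotope `χ`. -/
def IsRealizationOf {n : ℕ} (χ : Fin n → Fin n → Fin n → ℝ)
    (v : Fin n → Fin 3 → ℝ) : Prop :=
  ∀ i j k : Fin n, Real.sign (det3 (v i) (v j) (v k)) = χ i j k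

/-- A realizable rank-3 chirotope on `n` elements: an alternating map with values in
`{−1, 0, +1}`, not identically zero, realizable by vectors in `ℝ³`. -/
def IsRealizableChirotope {n : ℕ} (χ : Fin n → Fin n → Fin n → ℝ) : Prop :=
  IsAlternating3 χ ∧
  (∀ i j k : Fin n, χ i j k = 1 ∨ χ i j k = 0 ∨ χ i j k = -1) ∧
  (∃ i j k : Fin n, χ i j k ≠ 0) ∧
  ∃ v, IsRealizationOf χ v

/-- The normalized realization space of a rank-3 chirotope `χ`
(presupposing `χ 1 2 3 = +1`). -/
def chirotopeRealizationSpace {n : ℕ} (hn : 3 ≤ n)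
    (χ : Fin n → Fin n → Fin n → ℝ) : Set (Fin n → Fin 3 → ℝ) :=
  {v | v ⟨0, by omega⟩ = ![1, 0, 0] ∧ v ⟨1, by omega⟩ = ![0, 1, 0] ∧
       v ⟨2, by omega⟩ = ![0, 0, 1] ∧ IsRealizationOf χ v}

open SignType (sign)
open Filter

/-! ### Polynomial and rational functions -/

/-- A real function of finitely many real variables given by a polynomial. -/
def PolyFn {ι : Type} (f : (ι → ℝ) → ℝ) : Prop :=
  ∃ p : MvPolynomial ι ℝ, ∀ x, f x = MvPolynomial.eval x p

namespace PolyFn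

variable {ι κ : Type} {f g : (ι → ℝ) → ℝ}

theorem const (c : ℝ) : PolyFn (fun _ : ι → ℝ => c) := ⟨MvPolynomial.C c, by simp⟩

theorem coord (i : ι) : PolyFn (fun x : ι → ℝ => x i) := ⟨MvPolynomial.X i, by simp⟩

theorem add (hf : PolyFn f) (hg : PolyFn g) : PolyFn (fun x => f x + g x) := by
  obtain ⟨p, hp⟩ := hf
  obtain ⟨q, hq⟩ := hg
  exact ⟨p + q, by simp [hp, hq]⟩

theorem mul (hf : PolyFn f) (hg : PolyFn g) : PolyFn (fun x => f x * g x) := by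
  obtain ⟨p, hp⟩ := hf
  obtain ⟨q, hq⟩ := hg
  exact ⟨p * q, by simp [hp, hq]⟩

theorem sub (hf : PolyFn f) (hg : PolyFn g) : PolyFn (fun x => f x - g x) := by
  obtain ⟨p, hp⟩ := hf
  obtain ⟨q, hq⟩ := hg
  exact ⟨p - q, by simp [hp, hq]⟩

theorem comp_reindex (hf : PolyFn f) (e : ι → κ) :
    PolyFn (fun x : κ → ℝ => f (fun i => x (e i))) := by
  obtain ⟨p, hp⟩ := hf
  exact ⟨MvPolynomial.rename e p, fun x => by
    simp only [MvPolynomial.eval_rename]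
    exact hp _⟩

end PolyFn

/-- A function that is a quotient of polynomials with nonvanishing denominator on `S`. -/
def RatFnOn {ι : Type} (S : Set (ι → ℝ)) (f : (ι → ℝ) → ℝ) : Prop :=
  ∃ p q : MvPolynomial ι ℝ, ∀ x ∈ S,
    MvPolynomial.eval x q ≠ 0 ∧ f x = MvPolynomial.eval x p / MvPolynomial.eval x q

theorem PolyFn.ratFnOn {ι : Type} {f : (ι → ℝ) → ℝ} (hf : PolyFn f) (S : Set (ι → ℝ)) :
    RatFnOn S f := by
  obtain ⟨p, hp⟩ := hf
  exact ⟨p, 1, by simp [hp]⟩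

theorem RatFnOn.div {ι : Type} {S : Set (ι → ℝ)} {f g : (ι → ℝ) → ℝ} (hf : RatFnOn S f)
    (hg : RatFnOn S g) (h0 : ∀ x ∈ S, g x ≠ 0) : RatFnOn S (fun x => f x / g x) := by
  obtain ⟨p, q, h⟩ := hf
  obtain ⟨p', q', h'⟩ := hg
  refine ⟨p * q', q * p', fun x hx => ?_⟩
  obtain ⟨h1, h2⟩ := h x hx
  obtain ⟨h3, h4⟩ := h' x hx
  have h5 := h0 x hx
  rw [h4] at h5
  have h6 : MvPolynomial.eval x p' ≠ 0 := fun h => h5 (by simp [h])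
  refine ⟨by simp [h1, h6], ?_⟩
  simp only [h2, h4, map_mul]
  field_simp

/-- A function of `(x, u)` that is affine in `u` with coefficients polynomial in `x`. -/
def AffFn {ι υ : Type} [Fintype υ] (F : (ι → ℝ) → (υ → ℝ) → ℝ) : Prop :=
  ∃ (a : υ → (ι → ℝ) → ℝ) (b : (ι → ℝ) → ℝ), (∀ j, PolyFn (a j)) ∧ PolyFn b ∧
    ∀ x u, F x u = (∑ j, a j x * u j) + b x

namespace AffFn

variable {ι υ : Type} [Fintype υ] {F G : (ι → ℝ) → (υ → ℝ) → ℝ}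

theorem of_polyFn {f : (ι → ℝ) → ℝ} (hf : PolyFn f) : AffFn (fun x (_ : υ → ℝ) => f x) :=
  ⟨fun _ _ => 0, f, fun _ => .const 0, hf, by simp⟩

theorem coord (j : υ) : AffFn (fun (_ : ι → ℝ) (u : υ → ℝ) => u j) := by
  classical
  exact ⟨fun k _ => if k = j then 1 else 0, fun _ => 0, fun k => .const _, .const 0, by simp⟩

theorem add (hF : AffFn F) (hG : AffFn G) : AffFn (fun x u => F x u + G x u) := by
  obtain ⟨a, b, ha, hb, h⟩ := hF
  obtain ⟨a', b', ha', hb', h'⟩ := hG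
  refine ⟨fun j x => a j x + a' j x, fun x => b x + b' x, fun j => (ha j).add (ha' j),
    hb.add hb', fun x u => ?_⟩
  simp only [h, h', add_mul, Finset.sum_add_distrib]
  ring

theorem polyFn_mul {f : (ι → ℝ) → ℝ} (hf : PolyFn f) (hF : AffFn F) :
    AffFn (fun x u => f x * F x u) := by
  obtain ⟨a, b, ha, hb, h⟩ := hF
  refine ⟨fun j x => f x * a j x, fun x => f x * b x, fun j => hf.mul (ha j), hf.mul hb,
    fun x u => ?_⟩
  simp only [h, mul_add, Finset.mul_sum, mul_assoc]

theorem sub (hF : AffFn F) (hG : AffFn G) : AffFn (fun x u => F x u - G x u) := by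
  have := hF.add (polyFn_mul (.const (-1)) hG)
  simpa [sub_eq_add_neg] using this

end AffFn

/-! ### Stable equivalence of sets with arbitrary finite coordinate types -/

/-- Enumerate the coordinates of a subset of `ℝ^ι`. -/
def toFin {ι : Type} [Fintype ι] (S : Set (ι → ℝ)) : Σ d : ℕ, Set (Fin d → ℝ) :=
  ⟨Fintype.card ι, {x | (fun i => x (Fintype.equivFin ι i)) ∈ S}⟩

/-- Stable equivalence of sets with arbitrary finite coordinate types. -/
def SE {ι κ : Type} [Fintype ι] [Fintype κ] (S : Set (ι → ℝ)) (T : Set (κ → ℝ)) : Prop :=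
  StablyEquivalent (toFin S) (toFin T)

namespace SE

/-- A rational equivalence of sets in `ℝ^ι` and `ℝ^κ` induces one for any enumerations of the
coordinates. -/
theorem rationallyEquivalent_of_equiv {ι κ : Type} {d e : ℕ} (α : ι ≃ Fin d) (β : κ ≃ Fin e)
    {S : Set (ι → ℝ)} {T : Set (κ → ℝ)} (f : (ι → ℝ) → κ → ℝ) (g : (κ → ℝ) → ι → ℝ)
    (hf : ∀ k, RatFnOn S (fun x => f x k)) (hg : ∀ i, RatFnOn T (fun y => g y i))
    (h1 : ∀ x ∈ S, f x ∈ T ∧ g (f x) = x) (h2 : ∀ y ∈ T, g y ∈ S ∧ f (g y) = y) :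
    RationallyEquivalent {x : Fin d → ℝ | (fun i => x (α i)) ∈ S}
      {y : Fin e → ℝ | (fun k => y (β k)) ∈ T} := by
  refine ⟨fun x j => f (fun i => x (α i)) (β.symm j), fun y j => g (fun k => y (β k)) (α.symm j),
    ?_, ?_, ?_, ?_, ?_, ?_⟩
  · intro j
    obtain ⟨p, q, h⟩ := hf (β.symm j)
    refine ⟨MvPolynomial.rename α p, MvPolynomial.rename α q, fun x hx => ?_⟩
    simp only [MvPolynomial.eval_rename]
    exact h _ hx
  · intro j
    obtain ⟨p, q, h⟩ := hg (α.symm j)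
    refine ⟨MvPolynomial.rename β p, MvPolynomial.rename β q, fun x hx => ?_⟩
    simp only [MvPolynomial.eval_rename]
    exact h _ hx
  · intro x hx
    simpa using (h1 _ hx).1
  · intro x hx
    simpa using (h2 _ hx).1
  · intro x hx
    funext j
    simp [(h1 _ hx).2]
  · intro x hx
    funext j
    simp [(h2 _ hx).2]

variable {ι κ τ υ : Type} [Fintype ι] [Fintype κ] [Fintype τ] [Fintype υ]

theorem symm {S : Set (ι → ℝ)} {T : Set (κ → ℝ)} (h : SE S T) : SE T S :=
  Relation.EqvGen.symm _ _ h

theorem trans {S : Set (ι → ℝ)} {T : Set (κ → ℝ)} {U : Set (τ → ℝ)} (h : SE S T)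
    (h' : SE T U) : SE S U :=
  Relation.EqvGen.trans _ _ _ h h'

theorem refl (S : Set (ι → ℝ)) : SE S S := Relation.EqvGen.refl _

theorem of_rational {S : Set (ι → ℝ)} {T : Set (κ → ℝ)} (f : (ι → ℝ) → κ → ℝ)
    (g : (κ → ℝ) → ι → ℝ) (hf : ∀ k, RatFnOn S (fun x => f x k))
    (hg : ∀ i, RatFnOn T (fun y => g y i))
    (h1 : ∀ x ∈ S, f x ∈ T ∧ g (f x) = x) (h2 : ∀ y ∈ T, g y ∈ S ∧ f (g y) = y) : SE S T :=
  Relation.EqvGen.rel _ _ (Or.inr (rationallyEquivalent_of_equiv _ _ f g hf hg h1 h2))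

theorem of_polynomial {S : Set (ι → ℝ)} {T : Set (κ → ℝ)} (f : (ι → ℝ) → κ → ℝ)
    (g : (κ → ℝ) → ι → ℝ) (hf : ∀ k, PolyFn (fun x => f x k)) (hg : ∀ i, PolyFn (fun y => g y i))
    (h1 : ∀ x ∈ S, f x ∈ T ∧ g (f x) = x) (h2 : ∀ y ∈ T, g y ∈ S ∧ f (g y) = y) : SE S T :=
  of_rational f g (fun k => (hf k).ratFnOn S) (fun i => (hg i).ratFnOn T) h1 h2

/-- Adjoining coordinates subject to sign conditions that are affine in them. -/
theorem of_affine {K : Type} [Fintype K] (S : Set (ι → ℝ)) (F : K → (ι → ℝ) → (υ → ℝ) → ℝ)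
    (hF : ∀ k, AffFn (F k)) (s : K → SignType)
    (hne : ∀ x ∈ S, ∃ u, ∀ k, sign (F k x u) = s k) :
    SE S {w : ι ⊕ υ → ℝ | (fun i => w (.inl i)) ∈ S ∧
      ∀ k, sign (F k (fun i => w (.inl i)) (fun j => w (.inr j))) = s k} := by
  choose a b ha hb hab using hF
  choose A hA using ha
  choose B hB using hb
  let α := Fintype.equivFin ι
  let β := Fintype.equivFin υ
  let γ := Fintype.equivFin K
  let σ : SignType → ℝ := fun t => t
  let T' : Set (Fin (Fintype.card ι + Fintype.card υ) → ℝ) :=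
    {z | (fun i => z (Fin.castAdd _ (α i))) ∈ S ∧
      ∀ k, sign (F k (fun i => z (Fin.castAdd _ (α i))) (fun j => z (Fin.natAdd _ (β j)))) = s k}
  have key : ∀ (k : K) (x : Fin (Fintype.card ι) → ℝ) (y : Fin (Fintype.card υ) → ℝ),
      F k (fun i => x (α i)) (fun j => y (β j)) =
      (∑ j, MvPolynomial.eval x (MvPolynomial.rename α (A k (β.symm j))) * y j) +
        MvPolynomial.eval x (MvPolynomial.rename α (B k)) := by
    intro k x y
    rw [hab, hB, MvPolynomial.eval_rename, ← Equiv.sum_comp β]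
    simp only [MvPolynomial.eval_rename, hA, Equiv.symm_apply_apply]
    rfl
  have h1 : IsStableProjection {x : Fin (Fintype.card ι) → ℝ | (fun i => x (α i)) ∈ S} T' := by
    refine ⟨Fintype.card K, Fintype.card K,
      fun k j => if s (γ.symm k) = 0 then MvPolynomial.rename α (A (γ.symm k) (β.symm j)) else 0,
      fun k => if s (γ.symm k) = 0 then MvPolynomial.rename α (B (γ.symm k)) else 0,
      fun k j => MvPolynomial.C (σ (s (γ.symm k))) *
        MvPolynomial.rename α (A (γ.symm k) (β.symm j)),
      fun k => if s (γ.symm k) = 0 then 1 else MvPolynomial.C (σ (s (γ.symm k))) *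
        MvPolynomial.rename α (B (γ.symm k)), ?_, ?_⟩
    · intro x hx
      obtain ⟨u, hu⟩ := hne _ hx
      refine ⟨fun j => u (β.symm j), ?_⟩
      change _ ∧ _
      simp only [Fin.append_left, Fin.append_right, Equiv.symm_apply_apply]
      exact ⟨hx, hu⟩
    · intro x y
      change (_ ∧ _) ↔ (_ ∧ _)
      simp only [Fin.append_left, Fin.append_right]
      refine and_congr Iff.rfl ?_
      rw [← forall_and, ← Equiv.forall_congr_right γ]
      refine forall_congr' fun k => ?_
      simp only [Equiv.symm_apply_apply, key]
      simp only [map_mul, MvPolynomial.eval_C, mul_assoc, ← Finset.mul_sum]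
      generalize hs : s k = t
      cases t
      · simp [σ, sign_eq_zero_iff]
      · have : ((SignType.neg : SignType) = 0) = False := by simp
        simp only [this, if_false, σ, map_zero, zero_mul, Finset.sum_const_zero, add_zero, true_and,
          map_mul, MvPolynomial.eval_C, ← mul_add]
        rw [show SignType.neg = -1 from rfl, sign_eq_neg_one_iff]
        simpa using lt_neg_iff_add_neg.symm
      · have : ((SignType.pos : SignType) = 0) = False := by simp
        simp only [this, if_false, σ, map_zero, zero_mul, Finset.sum_const_zero, add_zero, true_and,
          map_mul, MvPolynomial.eval_C, ← mul_add]
        rw [show SignType.pos = 1 from rfl, sign_eq_one_iff]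
        simp
  refine Relation.EqvGen.trans _ ⟨_, T'⟩ _ (Relation.EqvGen.rel _ _ (Or.inl ⟨_, T', rfl, h1⟩)) ?_
  let δ : ι ⊕ υ ≃ Fin (Fintype.card ι + Fintype.card υ) := (α.sumCongr β).trans finSumFinEquiv
  let T : Set (ι ⊕ υ → ℝ) := {w | (fun i => w (.inl i)) ∈ S ∧
      ∀ k, sign (F k (fun i => w (.inl i)) (fun j => w (.inr j))) = s k}
  have h2 := rationallyEquivalent_of_equiv δ (Fintype.equivFin (ι ⊕ υ)) (S := T) (T := T)
    id id (fun k => (PolyFn.coord k).ratFnOn T) (fun k => (PolyFn.coord k).ratFnOn T)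
    (fun x hx => ⟨hx, rfl⟩) (fun x hx => ⟨hx, rfl⟩)
  exact Relation.EqvGen.rel _ _ (Or.inr h2)

/-- Adjoining coordinates subject to affine sign conditions, followed by a polynomial
change of coordinates. -/
theorem of_affine_polynomial {K : Type} [Fintype K] {S : Set (ι → ℝ)} {T : Set (κ → ℝ)}
    (F : K → (ι → ℝ) → (υ → ℝ) → ℝ)
    (hF : ∀ k, AffFn (F k)) (s : K → SignType)
    (hne : ∀ x ∈ S, ∃ u, ∀ k, sign (F k x u) = s k)
    (f : (ι → ℝ) → (υ → ℝ) → κ → ℝ) (g₁ : (κ → ℝ) → ι → ℝ) (g₂ : (κ → ℝ) → υ → ℝ)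
    (hf : ∀ k, PolyFn (fun w : ι ⊕ υ → ℝ => f (fun i => w (.inl i)) (fun j => w (.inr j)) k))
    (hg₁ : ∀ i, PolyFn (fun y => g₁ y i)) (hg₂ : ∀ j, PolyFn (fun y => g₂ y j))
    (h1 : ∀ x ∈ S, ∀ u, (∀ k, sign (F k x u) = s k) →
      f x u ∈ T ∧ g₁ (f x u) = x ∧ g₂ (f x u) = u)
    (h2 : ∀ y ∈ T, g₁ y ∈ S ∧ (∀ k, sign (F k (g₁ y) (g₂ y)) = s k) ∧ f (g₁ y) (g₂ y) = y) :
    SE S T := by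
  refine (of_affine S F hF s hne).trans (of_polynomial
    (fun w => f (fun i => w (.inl i)) (fun j => w (.inr j)))
    (fun y => Sum.elim (g₁ y) (g₂ y)) hf ?_ ?_ ?_)
  · rintro (i | j)
    · exact hg₁ i
    · exact hg₂ j
  · rintro w ⟨hw, hk⟩
    obtain ⟨ha, hb, hc⟩ := h1 _ hw _ hk
    refine ⟨ha, ?_⟩
    funext i
    rcases i with i | j
    · exact congrFun hb i
    · exact congrFun hc j
  · intro y hy
    obtain ⟨ha, hb, hc⟩ := h2 y hy
    exact ⟨⟨ha, hb⟩, hc⟩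

end SE

/-! ### Systems of elementary addition and multiplication relations -/

/-- An elementary relation `x i + x j = x k` or `x i * x j = x k`. -/
inductive ElemRel (κ : Type) : Type
  | add (i j k : κ) : ElemRel κ
  | mul (i j k : κ) : ElemRel κ

namespace ElemRel

/-- The relation is satisfied by the assignment `x`. -/
def Holds {κ : Type} : ElemRel κ → (κ → ℝ) → Prop
  | add i j k, x => x i + x j = x k
  | mul i j k, x => x i * x j = x k

theorem holds_add {κ : Type} (i j k : κ) (x : κ → ℝ) :
    (add i j k).Holds x ↔ x i + x j = x k := Iff.rfl

theorem holds_mul {κ : Type} (i j k : κ) (x : κ → ℝ) :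
    (mul i j k).Holds x ↔ x i * x j = x k := Iff.rfl

/-- Rename the variables of a relation. -/
def map {κ τ : Type} (f : κ → τ) : ElemRel κ → ElemRel τ
  | add i j k => add (f i) (f j) (f k)
  | mul i j k => mul (f i) (f j) (f k)

theorem holds_map {κ τ : Type} (f : κ → τ) (r : ElemRel κ) (x : τ → ℝ) :
    (r.map f).Holds x ↔ r.Holds (fun i => x (f i)) := by
  cases r <;> rfl

theorem forall_map_holds {κ τ : Type} (f : κ → τ) (R : List (ElemRel κ)) (x : τ → ℝ) :
    (∀ r ∈ R.map (map f), r.Holds x) ↔ ∀ r ∈ R, r.Holds (fun i => x (f i)) := by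
  simp [holds_map]

end ElemRel

/-- The positive solutions of a list of elementary relations. -/
def posSolutions {κ : Type} (R : List (ElemRel κ)) : Set (κ → ℝ) :=
  {z | (∀ i, 0 < z i) ∧ ∀ r ∈ R, r.Holds z}

/-- `v` is computed on positive inputs by adjoining finitely many positive intermediate values
determined by elementary relations; `none` stands for the constant `1`. -/
def Computable₁ {ι : Type} (v : (ι → ℝ) → ℝ) : Prop :=
  ∃ (κ : Type) (_ : Fintype κ) (R : List (ElemRel (Option ι ⊕ κ))) (h : κ → (ι → ℝ) → ℝ)
    (o : Option ι ⊕ κ), (∀ k, PolyFn (h k)) ∧ ∀ z : ι → ℝ, (∀ i, 0 < z i) →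
      (∀ k, 0 < h k z) ∧
      (∀ w : κ → ℝ, (∀ k, 0 < w k) →
        ((∀ r ∈ R, r.Holds (Sum.elim (fun a => a.elim 1 z) w)) ↔ ∀ k, w k = h k z)) ∧
      Sum.elim (fun a => a.elim 1 z) (fun k => h k z) o = v z

namespace Computable₁

variable {ι : Type} {u v r : (ι → ℝ) → ℝ}

theorem base (o : Option ι) : Computable₁ (fun z : ι → ℝ => o.elim 1 z) :=
  ⟨Empty, inferInstance, [], fun k => k.elim, .inl o, fun k => k.elim, fun z _ =>
    ⟨fun k => k.elim, fun _ _ => ⟨fun _ k => k.elim, fun _ => by simp⟩, rfl⟩⟩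

theorem congr (hu : Computable₁ u) (h : ∀ z, (∀ i, 0 < z i) → u z = v z) : Computable₁ v := by
  obtain ⟨κ, _, R, h', o, hh, H⟩ := hu
  exact ⟨κ, inferInstance, R, h', o, hh, fun z hz =>
    ⟨(H z hz).1, (H z hz).2.1, (H z hz).2.2.trans (h z hz)⟩⟩

/-- Adjoin a value `r` determined by one elementary relation with two computed values. -/
theorem step (hu : Computable₁ u) (hv : Computable₁ v) (hr : PolyFn r)
    (hpos : ∀ z, (∀ i, 0 < z i) → 0 < r z) (ρ : ∀ {X : Type}, X → X → X → ElemRel X)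
    (hρ : ∀ {X : Type} (i j k : X) (y : X → ℝ) (z : ι → ℝ), (∀ i, 0 < z i) → y i = u z →
      y j = v z → ((ρ i j k).Holds y ↔ y k = r z)) : Computable₁ r := by
  obtain ⟨κ, _, R, h, o, hh, H⟩ := hu
  obtain ⟨κ', _, R', h', o', hh', H'⟩ := hv
  let e : Option ι ⊕ κ → Option ι ⊕ ((κ ⊕ κ') ⊕ Unit) := Sum.map id (fun k => .inl (.inl k))
  let e' : Option ι ⊕ κ' → Option ι ⊕ ((κ ⊕ κ') ⊕ Unit) := Sum.map id (fun k => .inl (.inr k))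
  refine ⟨(κ ⊕ κ') ⊕ Unit, inferInstance,
    R.map (ElemRel.map e) ++ R'.map (ElemRel.map e') ++ [ρ (e o) (e' o') (.inr (.inr ()))],
    Sum.elim (Sum.elim h h') (fun _ => r), .inr (.inr ()), ?_, fun z hz => ?_⟩
  · rintro ((k | k) | k)
    exacts [hh k, hh' k, hr]
  obtain ⟨p1, p2, p3⟩ := H z hz
  obtain ⟨q1, q2, q3⟩ := H' z hz
  refine ⟨?_, fun w hw => ?_, rfl⟩
  · rintro ((k | k) | k)
    exacts [p1 k, q1 k, hpos z hz]
  have E : ∀ y : Option ι ⊕ ((κ ⊕ κ') ⊕ Unit) → ℝ,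
      (∀ r ∈ R.map (ElemRel.map e) ++ R'.map (ElemRel.map e') ++ [ρ (e o) (e' o') (.inr (.inr ()))],
        r.Holds y) ↔ (∀ r ∈ R, r.Holds (fun i => y (e i))) ∧
          (∀ r ∈ R', r.Holds (fun i => y (e' i))) ∧
          (ρ (e o) (e' o') (.inr (.inr ()))).Holds y := by
    intro y
    simp only [List.mem_append, or_imp, forall_and, ElemRel.forall_map_holds, List.mem_singleton,
      forall_eq, and_assoc]
  rw [E]
  have e1 : (fun i => Sum.elim (fun a => a.elim 1 z) w (e i)) =
      Sum.elim (fun a : Option ι => a.elim 1 z) (fun k => w (.inl (.inl k))) := by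
    funext i; rcases i with i | i <;> rfl
  have e2 : (fun i => Sum.elim (fun a => a.elim 1 z) w (e' i)) =
      Sum.elim (fun a : Option ι => a.elim 1 z) (fun k => w (.inl (.inr k))) := by
    funext i; rcases i with i | i <;> rfl
  rw [e1, e2, p2 _ (fun k => hw _), q2 _ (fun k => hw _)]
  have key : (∀ k, w (.inl (.inl k)) = h k z) → (∀ k, w (.inl (.inr k)) = h' k z) →
      ((ρ (e o) (e' o') (.inr (.inr ()))).Holds (Sum.elim (fun a => a.elim 1 z) w) ↔
        w (.inr ()) = r z) := by
    intro a b
    refine hρ _ _ _ _ z hz ?_ ?_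
    · rw [← p3]
      refine (congrFun e1 o).trans ?_
      simp only [a]
    · rw [← q3]
      refine (congrFun e2 o').trans ?_
      simp only [b]
  constructor
  · rintro ⟨a, b, c⟩
    rintro ((k | k) | k)
    exacts [a k, b k, (key a b).1 c]
  · intro a
    have a1 := fun k => a (.inl (.inl k))
    have a2 := fun k => a (.inl (.inr k))
    exact ⟨a1, a2, (key a1 a2).2 (a (.inr ()))⟩

theorem polyFn_aeval (p : MvPolynomial ι ℕ) : PolyFn (fun z : ι → ℝ => MvPolynomial.aeval z p) :=
  ⟨MvPolynomial.map (Nat.castRingHom ℝ) p, fun z => by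
    simp only [MvPolynomial.eval_map, MvPolynomial.aeval_def]; rfl⟩

theorem aeval_nonneg (p : MvPolynomial ι ℕ) (z : ι → ℝ) (hz : ∀ i, 0 < z i) :
    0 ≤ MvPolynomial.aeval z p := by
  induction p using MvPolynomial.induction_on with
  | C a => simp
  | add p q hp hq => simpa using add_nonneg hp hq
  | mul_X p i hp => simpa using mul_nonneg hp (hz i).le

/-- Polynomials with natural number coefficients are computable after adding `1`. -/
theorem one_add_aeval (p : MvPolynomial ι ℕ) :
    Computable₁ (fun z : ι → ℝ => 1 + MvPolynomial.aeval z p) := by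
  have poly := fun p : MvPolynomial ι ℕ => (PolyFn.const 1).add (polyFn_aeval p)
  have pos := fun (p : MvPolynomial ι ℕ) (z : ι → ℝ) (hz : ∀ i, 0 < z i) => aeval_nonneg p z hz
  have hadd : ∀ p q : MvPolynomial ι ℕ, Computable₁ (fun z => 1 + MvPolynomial.aeval z p) →
      Computable₁ (fun z => 1 + MvPolynomial.aeval z q) →
      Computable₁ (fun z => 1 + MvPolynomial.aeval z (p + q)) := by
    intro p q hp hq
    have h1 : Computable₁
        (fun z => (1 + MvPolynomial.aeval z p) + (1 + MvPolynomial.aeval z q)) :=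
      step hp hq ((poly p).add (poly q))
        (fun z hz => by have := pos p z hz; have := pos q z hz; positivity)
        (fun i j k => .add i j k)
        (fun i j k y z _ hi hj => by simp only [ElemRel.Holds, hi, hj]; exact eq_comm)
    refine step h1 (base none) (poly (p + q))
      (fun z hz => by have := pos (p + q) z hz; positivity) (fun i j k => .add j k i)
      (fun i j k y z _ hi hj => ?_)
    simp only [ElemRel.Holds, hi, hj, Option.elim_none, map_add]
    constructor <;> intro h <;> linarith
  induction p using MvPolynomial.induction_on with
  | C a =>
    induction a with
    | zero => exact (base none).congr (fun z _ => by simp)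
    | succ a ih =>
      rw [map_add]
      refine hadd _ _ ih ?_
      exact step (base none) (base none) (poly _) (fun z _ => by simp) (fun i j k => .add i j k)
        (fun i j k y z _ hi hj => by simp only [ElemRel.Holds, hi, hj]; simp [eq_comm])
  | add p q hp hq => exact hadd p q hp hq
  | mul_X p n hp =>
    have h1 : Computable₁ (fun z => (1 + MvPolynomial.aeval z p) * z n) :=
      step hp (base (some n)) ((poly p).mul (.coord n))
        (fun z hz => by have := pos p z hz; have := hz n; positivity) (fun i j k => .mul i j k)
        (fun i j k y z _ hi hj => by simp only [ElemRel.Holds, hi, hj]; exact eq_comm)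
    have h2 : Computable₁ (fun z => (1 + MvPolynomial.aeval z p) * z n + 1) :=
      step h1 (base none) (((poly p).mul (.coord n)).add (.const 1))
        (fun z hz => by have := pos p z hz; have := hz n; positivity) (fun i j k => .add i j k)
        (fun i j k y z _ hi hj => by simp only [ElemRel.Holds, hi, hj]; exact eq_comm)
    refine step h2 (base (some n)) (poly _)
      (fun z hz => by have := pos (p * MvPolynomial.X n) z hz; positivity) (fun i j k => .add j k i)
      (fun i j k y z _ hi hj => ?_)
    simp only [ElemRel.Holds, hi, hj, Option.elim_some, map_mul, MvPolynomial.aeval_X]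
    constructor <;> intro h <;> linarith

end Computable₁

theorem exists_natPolynomial_sub {ι : Type} (p : MvPolynomial ι ℤ) :
    ∃ F G : MvPolynomial ι ℕ, ∀ z : ι → ℝ,
      MvPolynomial.aeval z p = MvPolynomial.aeval z F - MvPolynomial.aeval z G := by
  induction p using MvPolynomial.induction_on with
  | C a =>
    refine ⟨.C a.toNat, .C (-a).toNat, fun z => ?_⟩
    have h : a = (a.toNat : ℤ) - ((-a).toNat : ℤ) := by omega
    have h' := congrArg (Int.cast : ℤ → ℝ) h
    push_cast at h'
    simpa using h'
  | add p q hp hq =>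
    obtain ⟨F, G, h⟩ := hp
    obtain ⟨F', G', h'⟩ := hq
    exact ⟨F + F', G + G', fun z => by simp only [map_add, h, h']; ring⟩
  | mul_X p n hp =>
    obtain ⟨F, G, h⟩ := hp
    exact ⟨F * .X n, G * .X n, fun z => by simp only [map_mul, MvPolynomial.aeval_X, h]; ring⟩

/-- The positive zero set of an integer polynomial is the set of positive solutions of a list of
elementary relations. -/
theorem exists_posSolutions_of_zeroSet {ι : Type} [Fintype ι] (p : MvPolynomial ι ℤ) :
    ∃ (κ : Type) (_ : Fintype κ) (R : List (ElemRel κ)),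
      SE {z : ι → ℝ | (∀ i, 0 < z i) ∧ MvPolynomial.aeval z p = 0} (posSolutions R) := by
  obtain ⟨F, G, hFG⟩ := exists_natPolynomial_sub p
  obtain ⟨κ, _, R, h, o, hh, H⟩ := Computable₁.one_add_aeval F
  obtain ⟨κ', _, R', h', o', hh', H'⟩ := Computable₁.one_add_aeval G
  let e : Option ι ⊕ κ → Option ι ⊕ (κ ⊕ κ') := Sum.map id Sum.inl
  let e' : Option ι ⊕ κ' → Option ι ⊕ (κ ⊕ κ') := Sum.map id Sum.inr
  let l : Option ι ⊕ (κ ⊕ κ') := .inl none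
  have E : ∀ y : Option ι ⊕ (κ ⊕ κ') → ℝ,
      (∀ r ∈ R.map (ElemRel.map e) ++ R'.map (ElemRel.map e') ++ [.mul l l l, .mul (e o) l (e' o')],
        r.Holds y) ↔ (∀ r ∈ R, r.Holds (fun i => y (e i))) ∧
          (∀ r ∈ R', r.Holds (fun i => y (e' i))) ∧ y l * y l = y l ∧
          y (e o) * y l = y (e' o') := by
    intro y
    simp only [List.mem_append, or_imp, forall_and, ElemRel.forall_map_holds, List.mem_cons,
      forall_eq, and_assoc, ElemRel.holds_mul, List.not_mem_nil, false_imp_iff, and_true]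
  refine ⟨Option ι ⊕ (κ ⊕ κ'), inferInstance,
    R.map (ElemRel.map e) ++ R'.map (ElemRel.map e') ++ [.mul l l l, .mul (e o) l (e' o')], ?_⟩
  have split : ∀ (z : ι → ℝ) (w : κ → ℝ) (w' : κ' → ℝ),
      (fun i => Sum.elim (fun a : Option ι => a.elim 1 z) (Sum.elim w w') (e i)) =
        Sum.elim (fun a : Option ι => a.elim 1 z) w ∧
      (fun i => Sum.elim (fun a : Option ι => a.elim 1 z) (Sum.elim w w') (e' i)) =
        Sum.elim (fun a : Option ι => a.elim 1 z) w' := by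
    intro z w w'
    constructor <;> funext i <;> rcases i with i | i <;> rfl
  refine SE.of_polynomial
    (fun z => Sum.elim (fun a => a.elim 1 z) (Sum.elim (fun k => h k z) (fun k => h' k z)))
    (fun y i => y (.inl (some i))) ?_ (fun i => .coord _) ?_ ?_
  · rintro ((_ | i) | (k | k))
    exacts [.const 1, .coord i, hh k, hh' k]
  · rintro z ⟨hz, hp⟩
    obtain ⟨p1, p2, p3⟩ := H z hz
    obtain ⟨q1, q2, q3⟩ := H' z hz
    refine ⟨⟨?_, (E _).2 ?_⟩, rfl⟩
    · rintro ((_ | i) | (k | k))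
      exacts [one_pos, hz i, p1 k, q1 k]
    obtain ⟨s1, s2⟩ := split z (fun k => h k z) (fun k => h' k z)
    rw [s1, s2]
    refine ⟨(p2 _ p1).2 fun _ => rfl, (q2 _ q1).2 fun _ => rfl, mul_one _, ?_⟩
    have := hFG z
    have a := (congrFun s1 o).trans p3
    have b := (congrFun s2 o').trans q3
    simp only at a b
    rw [a, b]
    simp only [l, Sum.elim_inl, Option.elim_none]
    linarith
  · rintro y ⟨hy, hr⟩
    obtain ⟨r1, r2, r3, r4⟩ := (E _).1 hr
    have hl : y l = 1 := by
      have := hy l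
      exact mul_left_cancel₀ this.ne' (r3.trans (mul_one _).symm)
    let z : ι → ℝ := fun i => y (.inl (some i))
    have hyz : y = Sum.elim (fun a : Option ι => a.elim 1 z)
        (Sum.elim (fun k => y (.inr (.inl k))) (fun k => y (.inr (.inr k)))) := by
      funext i
      rcases i with (_ | i) | (k | k)
      exacts [hl, rfl, rfl, rfl]
    obtain ⟨s1, s2⟩ := split z (fun k => y (.inr (.inl k))) (fun k => y (.inr (.inr k)))
    rw [← hyz] at s1 s2
    obtain ⟨p1, p2, p3⟩ := H z (fun i => hy _)
    obtain ⟨q1, q2, q3⟩ := H' z (fun i => hy _)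
    rw [s1, p2 _ (fun _ => hy _)] at r1
    rw [s2, q2 _ (fun _ => hy _)] at r2
    have a := (congrFun s1 o)
    have b := (congrFun s2 o')
    simp only [r1, r2] at a b
    rw [p3] at a
    rw [q3] at b
    rw [a, b, hl] at r4
    refine ⟨⟨fun i => hy _, ?_⟩, ?_⟩
    · change MvPolynomial.aeval z p = 0
      have := hFG z
      linarith
    · funext i
      rcases i with (_ | i) | (k | k)
      exacts [hl.symm, rfl, (r1 k).symm, (r2 k).symm]

/-- Every primary basic semialgebraic set over `ℤ` is stably equivalent to the positive solution
set of a list of elementary relations. -/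
theorem IsPrimaryBasicSemialgebraicZ.exists_posSolutions {m : ℕ} {V : Set (Fin m → ℝ)}
    (hV : IsPrimaryBasicSemialgebraicZ V) :
    ∃ (κ : Type) (_ : Fintype κ) (R : List (ElemRel κ)), SE V (posSolutions R) := by
  obtain ⟨k, l, f, g, rfl⟩ := hV
  let ι := (Fin m ⊕ Fin m) ⊕ Fin l
  let d : Fin m → MvPolynomial ι ℤ := fun i => .X (.inl (.inl i)) - .X (.inl (.inr i))
  let p : MvPolynomial ι ℤ := (∑ i, (MvPolynomial.aeval d (f i)) ^ 2) +
    ∑ j, (MvPolynomial.aeval d (g j) - .X (.inr j)) ^ 2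
  have hd : ∀ (q : MvPolynomial (Fin m) ℤ) (z : ι → ℝ),
      MvPolynomial.aeval z (MvPolynomial.aeval d q) =
      MvPolynomial.aeval (fun i => z (.inl (.inl i)) - z (.inl (.inr i))) q := by
    intro q z
    rw [← AlgHom.comp_apply, MvPolynomial.comp_aeval]
    simp [d]
  have hp : ∀ z : ι → ℝ, MvPolynomial.aeval z p = 0 ↔
      (∀ i, MvPolynomial.aeval (fun i => z (.inl (.inl i)) - z (.inl (.inr i))) (f i) = 0) ∧
      ∀ j, MvPolynomial.aeval (fun i => z (.inl (.inl i)) - z (.inl (.inr i))) (g j) =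
        z (.inr j) := by
    intro z
    simp only [p, map_add, map_sum, map_pow, map_sub, hd, MvPolynomial.aeval_X]
    rw [add_eq_zero_iff_of_nonneg (by positivity) (by positivity),
      Finset.sum_eq_zero_iff_of_nonneg (fun _ _ => by positivity),
      Finset.sum_eq_zero_iff_of_nonneg (fun _ _ => by positivity)]
    simp [sub_eq_zero]
  obtain ⟨κ, hκ, R, hR⟩ := exists_posSolutions_of_zeroSet p
  refine ⟨κ, hκ, R, SE.trans ?_ hR⟩
  refine SE.of_affine_polynomial (υ := Fin m) (K := Fin m ⊕ Fin m)
    (Sum.elim (fun i _ u => u i) (fun i x u => x i + u i)) ?_ (fun _ => 1) ?_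
    (fun x u => Sum.elim (Sum.elim (fun i => x i + u i) u) (fun j => MvPolynomial.aeval x (g j)))
    (fun z i => z (.inl (.inl i)) - z (.inl (.inr i))) (fun z i => z (.inl (.inr i)))
    ?_ (fun i => (PolyFn.coord _).sub (.coord _)) (fun i => .coord _) ?_ ?_
  · rintro (i | i)
    exacts [.coord i, (AffFn.of_polyFn (.coord i)).add (.coord i)]
  · intro x _
    refine ⟨fun i => 1 + |x i|, ?_⟩
    rintro (i | i) <;> apply sign_pos
    · simp only [Sum.elim_inl]; positivity
    · simp only [Sum.elim_inr]; linarith [neg_abs_le (x i)]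
  · rintro ((i | i) | j)
    · exact (PolyFn.coord _).add (.coord _)
    · exact .coord _
    · refine PolyFn.comp_reindex (f := fun x => MvPolynomial.aeval x (g j)) ?_ Sum.inl
      exact ⟨MvPolynomial.map (Int.castRingHom ℝ) (g j), fun z => by
        simp only [MvPolynomial.eval_map, MvPolynomial.aeval_def]; rfl⟩
  · rintro x ⟨hf, hg⟩ u hu
    refine ⟨⟨?_, (hp _).2 ?_⟩, ?_, rfl⟩
    · rintro ((i | i) | j)
      · exact sign_eq_one_iff.1 (hu (.inr i))
      · exact sign_eq_one_iff.1 (hu (.inl i))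
      · exact hg j
    · simpa using hf
    · funext i
      simp
  · rintro z ⟨hz, h0⟩
    obtain ⟨hf, hg⟩ := (hp z).1 h0
    refine ⟨⟨hf, fun j => ?_⟩, ?_, ?_⟩
    · rw [hg j]
      exact hz _
    · rintro (i | i) <;> apply sign_pos
      · exact hz _
      · simpa using hz _
    · funext i
      rcases i with (i | i) | j
      · simp
      · rfl
      · exact hg j

/-! ### Ordered systems of relations -/

/-- All values exceed `1` and have the order type prescribed by `σ`. -/
def HasOrderType {κ : Type} (σ : κ → κ → SignType) (x : κ → ℝ) : Prop :=
  (∀ i, 1 < x i) ∧ ∀ i j, sign (x i - x j) = σ i j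

/-- Solutions of a list of elementary relations with prescribed order type, subject to a further
condition. -/
def orderedSolutions {κ : Type} (σ : κ → κ → SignType) (R : List (ElemRel κ))
    (P : (κ → ℝ) → Prop) : Set (κ → ℝ) :=
  {x | HasOrderType σ x ∧ (∀ r ∈ R, r.Holds x) ∧ P x}

theorem orderedSolutions_mono {κ : Type} {σ : κ → κ → SignType} {R : List (ElemRel κ)}
    {P Q : (κ → ℝ) → Prop} (h : ∀ x, P x → Q x) :
    orderedSolutions σ R P ⊆ orderedSolutions σ R Q :=
  fun x hx => ⟨hx.1, hx.2.1, h x hx.2.2⟩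

theorem sign_sub_comm (x y : ℝ) : sign (x - y) = -sign (y - x) := by
  rw [← Left.sign_neg, neg_sub]

/-- Adjoin values `a t x * u + b t x`, for a sufficiently large free parameter `u`, to an ordered
system. Equalities among the new values may take over part of the pending condition. -/
theorem exists_orderedSolutions_extension {κ : Type} [Fintype κ] {N : ℕ}
    {σ : κ → κ → SignType} {R : List (ElemRel κ)} {P : (κ → ℝ) → Prop}
    (hne : (orderedSolutions σ R P).Nonempty) (t₀ : Fin N) (a b : Fin N → (κ → ℝ) → ℝ)
    (ha : ∀ t, PolyFn (a t)) (hb : ∀ t, PolyFn (b t))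
    (hpos : ∀ x ∈ orderedSolutions σ R P, ∀ t, 0 < a t x)
    (h0 : ∀ x, a t₀ x = 1 ∧ b t₀ x = 0) (R' : List (ElemRel (κ ⊕ Fin N)))
    (hR' : ∀ y : κ ⊕ Fin N → ℝ, (∀ r ∈ R', r.Holds y) ↔ ∀ t, y (.inr t) =
      a t (fun i => y (.inl i)) * y (.inr t₀) + b t (fun i => y (.inl i)))
    (hs : ∀ t t', t < t' → ∃ s, ∀ x ∈ orderedSolutions σ R P, ∀ᶠ u in atTop,
      sign ((a t x * u + b t x) - (a t' x * u + b t' x)) = s)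
    (P' : (κ → ℝ) → Prop) (hP : ∀ x, P x → P' x)
    (hP' : ∀ x u, (∀ t t', t < t' → (∀ x ∈ orderedSolutions σ R P, ∀ u : ℝ,
      a t x * u + b t x = a t' x * u + b t' x) → a t x * u + b t x = a t' x * u + b t' x) →
      P' x → P x) :
    ∃ (σ' : κ ⊕ Fin N → κ ⊕ Fin N → SignType) (R'' : List (ElemRel (κ ⊕ Fin N))),
      SE (orderedSolutions σ R P) (orderedSolutions σ' R'' (fun y => P' (fun i => y (.inl i)))) ∧
      (orderedSolutions σ' R'' (fun y => P' (fun i => y (.inl i)))).Nonempty ∧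
      (∀ y ∈ orderedSolutions σ' R'' (fun y => P' (fun i => y (.inl i))),
        (fun i => y (.inl i)) ∈ orderedSolutions σ R P) ∧
      ∀ y ∈ orderedSolutions σ' R'' (fun _ => True),
        (fun i => y (.inl i)) ∈ orderedSolutions σ R (fun _ => True) ∧
        (∀ t, y (.inr t) = a t (fun i => y (.inl i)) * y (.inr t₀) + b t (fun i => y (.inl i))) ∧
        ∀ i t, y (.inl i) < y (.inr t) := by
  classical
  set Z := orderedSolutions σ R P with hZ
  have hs' : ∀ t t', ∃ s, ∀ x ∈ Z, ∀ᶠ u in atTop,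
      sign ((a t x * u + b t x) - (a t' x * u + b t' x)) = s := by
    intro t t'
    rcases lt_trichotomy t t' with h | rfl | h
    · exact hs t t' h
    · exact ⟨0, fun x _ => .of_forall fun u => by simp⟩
    · obtain ⟨s, h⟩ := hs t' t h
      exact ⟨-s, fun x hx => (h x hx).mono fun u hu => by rw [sign_sub_comm, hu]⟩
  choose s hs' using hs'
  let σ' : κ ⊕ Fin N → κ ⊕ Fin N → SignType :=
    Sum.elim (fun i => Sum.elim (σ i) (fun _ => -1)) (fun t => Sum.elim (fun _ => 1) (s t))
  let R'' := R.map (ElemRel.map .inl) ++ R'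
  let φ : Fin N → (κ → ℝ) → ℝ → ℝ := fun t x u => a t x * u + b t x
  let K := (Option κ × Fin N) ⊕ (Fin N × Fin N)
  let F : K → (κ → ℝ) → (Unit → ℝ) → ℝ :=
    Sum.elim (fun p x u => φ p.2 x (u ()) - p.1.elim 1 x)
      (fun p x u => φ p.1 x (u ()) - φ p.2 x (u ()))
  let S : K → SignType := Sum.elim (fun _ => 1) (fun p => s p.1 p.2)
  let T := orderedSolutions σ' R'' (fun y => P' (fun i => y (.inl i)))
  have hφ : ∀ t, AffFn (fun x (u : Unit → ℝ) => φ t x (u ())) := fun t =>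
    (AffFn.polyFn_mul (ha t) (.coord ())).add (.of_polyFn (hb t))
  have hF : ∀ k, AffFn (F k) := by
    rintro (⟨o, t⟩ | ⟨t, t'⟩)
    · refine (hφ t).sub (.of_polyFn ?_)
      rcases o with _ | i
      exacts [.const 1, .coord i]
    · exact (hφ t).sub (hφ t')
  have hne' : ∀ x ∈ Z, ∃ u, ∀ k, sign (F k x u) = S k := by
    intro x hx
    have h1 : ∀ᶠ u : ℝ in atTop, ∀ k, sign (F k x (fun _ => u)) = S k := by
      rw [eventually_all]
      rintro (⟨o, t⟩ | ⟨t, t'⟩)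
      · have h2 : Tendsto (fun u => φ t x u) atTop atTop :=
          tendsto_atTop_add_const_right _ _ (tendsto_id.const_mul_atTop (hpos x hx t))
        exact (h2.eventually_gt_atTop (o.elim 1 x)).mono fun u hu => sign_pos (sub_pos.2 hu)
      · exact hs' t t' x hx
    obtain ⟨u, hu⟩ := h1.exists
    exact ⟨_, hu⟩
  have hT : ∀ x ∈ Z, ∀ u : Unit → ℝ, (∀ k, sign (F k x u) = S k) →
      Sum.elim x (fun t => φ t x (u ())) ∈ T := by
    rintro x ⟨⟨x1, x2⟩, x3, x4⟩ u hu
    have hu1 : ∀ (o : Option κ) t, o.elim 1 x < φ t x (u ()) := fun o t =>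
      sub_pos.1 (sign_eq_one_iff.1 (hu (.inl (o, t))))
    refine ⟨⟨?_, ?_⟩, ?_, hP x x4⟩
    · rintro (i | t)
      exacts [x1 i, hu1 none t]
    · rintro (i | t) (j | t')
      · exact x2 i j
      · exact sign_neg (sub_neg.2 (hu1 (some i) t'))
      · exact sign_pos (sub_pos.2 (hu1 (some j) t))
      · exact hu (.inr (t, t'))
    · simp only [R'', List.mem_append, or_imp, forall_and, ElemRel.forall_map_holds]
      refine ⟨x3, (hR' _).2 fun t => ?_⟩
      have := h0 x
      simp [φ, this]
  have values : ∀ y ∈ orderedSolutions σ' R'' (fun _ => True),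
      (fun i => y (.inl i)) ∈ orderedSolutions σ R (fun _ => True) ∧
        (∀ t, y (.inr t) = φ t (fun i => y (.inl i)) (y (.inr t₀))) ∧
        ∀ i t, y (.inl i) < y (.inr t) := by
    rintro y ⟨⟨y1, y2⟩, y3, -⟩
    simp only [R'', List.mem_append, or_imp, forall_and, ElemRel.forall_map_holds] at y3
    refine ⟨⟨⟨fun i => y1 _, fun i j => y2 _ _⟩, y3.1, trivial⟩, (hR' y).1 y3.2, fun i t => ?_⟩
    have := y2 (.inl i) (.inr t)
    exact sub_neg.1 (sign_eq_neg_one_iff.1 this)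
  have restrict : ∀ y ∈ T, (fun i => y (.inl i)) ∈ Z := by
    intro y hy
    obtain ⟨⟨y1, y2, -⟩, hv, -⟩ := values y (orderedSolutions_mono (fun _ _ => trivial) hy)
    refine ⟨y1, y2, hP' _ (y (.inr t₀)) ?_ hy.2.2⟩
    intro t t' _ h
    obtain ⟨x, hx⟩ := hne
    obtain ⟨u, hu⟩ := (hs' t t' x hx).exists
    have h1 : s t t' = 0 := by rw [← hu, h x hx u, sub_self, sign_zero]
    have h2 := hy.1.2 (.inr t) (.inr t')
    change _ = s t t' at h2
    rw [h1, sign_eq_zero_iff, sub_eq_zero, hv t, hv t'] at h2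
    exact h2
  refine ⟨σ', R'', ?_, ?_, restrict, values⟩
  · refine SE.of_affine_polynomial F hF S hne' (fun x u => Sum.elim x (fun t => φ t x (u ())))
      (fun y i => y (.inl i)) (fun y _ => y (.inr t₀)) ?_ (fun i => .coord _) (fun _ => .coord _)
      (fun x hx u hu => ⟨hT x hx u hu, rfl, ?_⟩) ?_
    · rintro (i | t)
      · exact .coord _
      · exact (((ha t).comp_reindex Sum.inl).mul (.coord _)).add ((hb t).comp_reindex Sum.inl)
    · funext _
      have := h0 x
      simp [φ, this]
    · intro y hy
      obtain ⟨-, y2, y3⟩ := values y (orderedSolutions_mono (fun _ _ => trivial) hy)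
      refine ⟨restrict y hy, ?_, ?_⟩
      · rintro (⟨o, t⟩ | ⟨t, t'⟩)
        · refine sign_pos (sub_pos.2 ?_)
          rw [← y2]
          rcases o with _ | i
          exacts [hy.1.1 _, y3 i t]
        · have := hy.1.2 (.inr t) (.inr t')
          rwa [y2 t, y2 t'] at this
      · funext i
        rcases i with i | t
        exacts [rfl, (y2 t).symm]
  · obtain ⟨x, hx⟩ := hne
    obtain ⟨u, hu⟩ := hne' x hx
    exact ⟨_, hT x hx u hu⟩

/-- Adjoin `w`, `w + a`, `w + b`, `w + a + d`, `w + b + c` for a large parameter `w`. -/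
theorem exists_twoSums_extension {κ : Type} [Fintype κ]
    {σ : κ → κ → SignType} {R : List (ElemRel κ)} {P : (κ → ℝ) → Prop}
    (hne : (orderedSolutions σ R P).Nonempty) (a b c d : κ)
    (hab : ∀ x ∈ orderedSolutions σ R P, x a < x b)
    (hbd : ∀ x ∈ orderedSolutions σ R P, x b < x a + x d)
    (s : SignType) (hs : ∀ x ∈ orderedSolutions σ R P, sign ((x a + x d) - (x b + x c)) = s)
    (P' : (κ → ℝ) → Prop) (hP : ∀ x, P x → P' x)
    (hP' : ∀ x, (s = 0 → x a + x d = x b + x c) → P' x → P x) :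
    ∃ (σ' : κ ⊕ Fin 5 → κ ⊕ Fin 5 → SignType) (R'' : List (ElemRel (κ ⊕ Fin 5))),
      SE (orderedSolutions σ R P) (orderedSolutions σ' R'' (fun y => P' (fun i => y (.inl i)))) ∧
      (orderedSolutions σ' R'' (fun y => P' (fun i => y (.inl i)))).Nonempty ∧
      (∀ y ∈ orderedSolutions σ' R'' (fun y => P' (fun i => y (.inl i))),
        (fun i => y (.inl i)) ∈ orderedSolutions σ R P) ∧
      ∀ y ∈ orderedSolutions σ' R'' (fun _ => True),
        (fun i => y (.inl i)) ∈ orderedSolutions σ R (fun _ => True) ∧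
        (y (.inr 1) = y (.inr 0) + y (.inl a) ∧ y (.inr 2) = y (.inr 0) + y (.inl b) ∧
          y (.inr 3) = y (.inr 0) + (y (.inl a) + y (.inl d)) ∧
          y (.inr 4) = y (.inr 0) + (y (.inl b) + y (.inl c))) ∧
        ∀ i t, y (.inl i) < y (.inr t) := by
  let B : Fin 5 → (κ → ℝ) → ℝ :=
    ![fun _ => 0, fun x => x a, fun x => x b, fun x => x a + x d, fun x => x b + x c]
  refine Exists.imp (fun σ' => Exists.imp fun R'' => ?_)
    (exists_orderedSolutions_extension hne 0 (fun _ _ => 1) B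
      (fun _ => .const 1) ?_ (fun _ _ _ => one_pos) (fun x => ⟨rfl, rfl⟩)
      [.add (.inr 0) (.inl a) (.inr 1), .add (.inr 0) (.inl b) (.inr 2),
        .add (.inr 1) (.inl d) (.inr 3), .add (.inr 2) (.inl c) (.inr 4)] ?_ ?_ P' hP ?_)
  · rintro ⟨h1, h2, h4, h3⟩
    refine ⟨h1, h2, h4, fun y hy => ?_⟩
    obtain ⟨y1, y2, y3⟩ := h3 y hy
    refine ⟨y1, ⟨?_, ?_, ?_, ?_⟩, y3⟩
    · simpa [B] using y2 1
    · simpa [B] using y2 2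
    · simpa [B] using y2 3
    · simpa [B] using y2 4
  · intro t
    fin_cases t
    exacts [.const 0, .coord a, .coord b, (PolyFn.coord a).add (.coord d),
      (PolyFn.coord b).add (.coord c)]
  · intro y
    simp only [List.mem_cons, forall_eq_or_imp, ElemRel.holds_add, List.not_mem_nil,
      false_imp_iff, implies_true, and_true, Fin.forall_fin_succ, B]
    simp
    constructor
    · rintro ⟨h1, h2, h3, h4⟩
      refine ⟨?_, ?_, ?_, ?_⟩ <;> linarith
    · rintro ⟨h1, h2, h3, h4⟩
      refine ⟨?_, ?_, ?_, ?_⟩ <;> linarith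
  · have hlt : ∀ t t', (∀ x ∈ orderedSolutions σ R P, B t x < B t' x) →
        ∃ s, ∀ x ∈ orderedSolutions σ R P, ∀ᶠ u : ℝ in atTop,
          sign ((1 * u + B t x) - (1 * u + B t' x)) = s := fun t t' h =>
      ⟨-1, fun x hx => .of_forall fun u => sign_neg (by linarith [h x hx])⟩
    have key : ∀ x ∈ orderedSolutions σ R P,
        B 0 x < B 1 x ∧ B 1 x < B 2 x ∧ B 2 x < B 3 x ∧ B 2 x < B 4 x := by
      intro x hx
      have ha := hx.1.1 a
      have hc := hx.1.1 c
      have h1 := hab x hx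
      have h2 := hbd x hx
      refine ⟨?_, h1, h2, ?_⟩
      · change 0 < x a
        linarith
      · change x b < x b + x c
        linarith
    intro t t' htt
    by_cases h34 : t = 3
    · obtain rfl : t' = 4 := by omega
      subst h34
      refine ⟨s, fun x hx => .of_forall fun u => ?_⟩
      rw [← hs x hx, add_sub_add_left_eq_sub]
      rfl
    · apply hlt
      intro x hx
      obtain ⟨k1, k2, k3, k4⟩ := key x hx
      fin_cases t <;> fin_cases t' <;> simp at htt h34 ⊢ <;> linarith
  · intro x u h
    refine hP' x fun h0 => ?_
    have := h 3 4 (by decide) (fun x hx u => ?_)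
    · simpa [B] using this
    · have := hs x hx
      rw [h0, sign_eq_zero_iff, sub_eq_zero] at this
      change 1 * u + (x a + x d) = 1 * u + (x b + x c)
      rw [this]

/-- Adjoin `u`, `u + c`, `u + d` and their products with `a` and `b` for a large parameter `u`. -/
theorem exists_products_extension {κ : Type} [Fintype κ]
    {σ : κ → κ → SignType} {R : List (ElemRel κ)} {P : (κ → ℝ) → Prop}
    (hne : (orderedSolutions σ R P).Nonempty) (a b c d : κ)
    (hab : ∀ x ∈ orderedSolutions σ R P, x a < x b)
    (hcd : ∀ x ∈ orderedSolutions σ R P, x c < x d) :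
    ∃ (σ' : κ ⊕ Fin 7 → κ ⊕ Fin 7 → SignType) (R'' : List (ElemRel (κ ⊕ Fin 7))),
      SE (orderedSolutions σ R P) (orderedSolutions σ' R'' (fun y => P (fun i => y (.inl i)))) ∧
      (orderedSolutions σ' R'' (fun y => P (fun i => y (.inl i)))).Nonempty ∧
      (∀ y ∈ orderedSolutions σ' R'' (fun y => P (fun i => y (.inl i))),
        (fun i => y (.inl i)) ∈ orderedSolutions σ R P) ∧
      ∀ y ∈ orderedSolutions σ' R'' (fun _ => True),
        (fun i => y (.inl i)) ∈ orderedSolutions σ R (fun _ => True) ∧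
        (y (.inr 3) = y (.inl a) * (y (.inr 0) + y (.inl c)) ∧
          y (.inr 4) = y (.inl a) * (y (.inr 0) + y (.inl d)) ∧
          y (.inr 5) = y (.inl b) * (y (.inr 0) + y (.inl c)) ∧
          y (.inr 6) = y (.inl b) * (y (.inr 0) + y (.inl d))) ∧
        ∀ i t, y (.inl i) < y (.inr t) := by
  let A : Fin 7 → (κ → ℝ) → ℝ := ![fun _ => 1, fun _ => 1, fun _ => 1,
    fun x => x a, fun x => x a, fun x => x b, fun x => x b]
  let B : Fin 7 → (κ → ℝ) → ℝ := ![fun _ => 0, fun x => x c, fun x => x d,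
    fun x => x a * x c, fun x => x a * x d, fun x => x b * x c, fun x => x b * x d]
  refine Exists.imp (fun σ' => Exists.imp fun R'' => ?_)
    (exists_orderedSolutions_extension hne 0 A B ?_ ?_ ?_ (fun x => ⟨rfl, rfl⟩)
      [.add (.inr 0) (.inl c) (.inr 1), .add (.inr 0) (.inl d) (.inr 2),
        .mul (.inl a) (.inr 1) (.inr 3), .mul (.inl a) (.inr 2) (.inr 4),
        .mul (.inl b) (.inr 1) (.inr 5), .mul (.inl b) (.inr 2) (.inr 6)] ?_ ?_
      P (fun _ => id) (fun _ _ _ => id))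
  · rintro ⟨h1, h2, h4, h3⟩
    refine ⟨h1, h2, h4, fun y hy => ?_⟩
    obtain ⟨y1, y2, y3⟩ := h3 y hy
    refine ⟨y1, ⟨?_, ?_, ?_, ?_⟩, y3⟩
    · simpa [A, B, mul_add] using y2 3
    · simpa [A, B, mul_add] using y2 4
    · simpa [A, B, mul_add] using y2 5
    · simpa [A, B, mul_add] using y2 6
  · intro t
    fin_cases t
    exacts [.const 1, .const 1, .const 1, .coord a, .coord a, .coord b, .coord b]
  · intro t
    fin_cases t
    exacts [.const 0, .coord c, .coord d, (PolyFn.coord a).mul (.coord c),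
      (PolyFn.coord a).mul (.coord d), (PolyFn.coord b).mul (.coord c),
      (PolyFn.coord b).mul (.coord d)]
  · intro x hx t
    have ha := hx.1.1 a
    have hb := hx.1.1 b
    fin_cases t <;> simp [A] <;> linarith
  · intro y
    simp only [List.mem_cons, forall_eq_or_imp, ElemRel.holds_add, ElemRel.holds_mul,
      List.not_mem_nil, false_imp_iff, implies_true, and_true, Fin.forall_fin_succ, A, B]
    simp
    constructor
    · rintro ⟨h1, h2, h3, h4, h5, h6⟩
      rw [← h1] at h3 h5
      rw [← h2] at h4 h6
      refine ⟨?_, ?_, ?_, ?_, ?_, ?_⟩ <;> linarith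
    · rintro ⟨h1, h2, h3, h4, h5, h6⟩
      rw [h1, h2, h3, h4, h5, h6]
      refine ⟨?_, ?_, ?_, ?_, ?_, ?_⟩ <;> ring
  · have key : ∀ x ∈ orderedSolutions σ R P, ∀ᶠ u : ℝ in atTop,
        StrictMono (fun t => A t x * u + B t x) := by
      intro x hx
      have ha := hx.1.1 a
      have hc := hx.1.1 c
      have h1 := hab x hx
      have h2 := hcd x hx
      filter_upwards [eventually_gt_atTop 0, eventually_gt_atTop (x d / (x a - 1)),
        eventually_gt_atTop (x a * x d / (x b - x a))] with u hu0 hu1 hu2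
      rw [div_lt_iff₀ (by linarith)] at hu1 hu2
      rw [Fin.strictMono_iff_lt_succ]
      have h3 : x a * x c < x a * x d := mul_lt_mul_of_pos_left h2 (by linarith)
      have h4 : x b * x c < x b * x d := mul_lt_mul_of_pos_left h2 (by linarith)
      have h5 : 0 < x a * x c := by positivity
      have h6 : 0 < x b * x c := mul_pos (by linarith) (by linarith)
      intro t
      fin_cases t <;> simp [A, B] <;> nlinarith
    intro t t' htt
    exact ⟨-1, fun x hx => (key x hx).mono fun u hu => sign_neg (sub_neg.2 (hu htt))⟩

/-- The condition that the elementary relation `r` holds for the differences `x (f i) - x (e i)`. -/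
def ElemRel.HoldsDiff {ι κ : Type} (e f : ι → κ) (r : ElemRel ι) (x : κ → ℝ) : Prop :=
  r.Holds (fun i => x (f i) - x (e i))

/-- Impose `x (f k) - x (e k) = x D - x C` for elements `C`, `D` above `f k`. -/
theorem exists_impose_difference {κ : Type} [Fintype κ]
    {σ : κ → κ → SignType} {R : List (ElemRel κ)} {P Q : (κ → ℝ) → Prop}
    (hne : (orderedSolutions σ R (fun x => Q x ∧ P x)).Nonempty) (e f C D : κ)
    (hef : ∀ x ∈ orderedSolutions σ R (fun x => Q x ∧ P x), x e < x f ∧ x f < x C)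
    (hQ : ∀ x ∈ orderedSolutions σ R (fun _ => True), Q x ↔ x f - x e = x C - x D) :
    ∃ (σ' : κ ⊕ Fin 5 → κ ⊕ Fin 5 → SignType) (R'' : List (ElemRel (κ ⊕ Fin 5))),
      SE (orderedSolutions σ R (fun x => Q x ∧ P x))
        (orderedSolutions σ' R'' (fun y => P (fun i => y (.inl i)))) ∧
      (orderedSolutions σ' R'' (fun y => P (fun i => y (.inl i)))).Nonempty ∧
      ∀ y ∈ orderedSolutions σ' R'' (fun y => P (fun i => y (.inl i))),
        (fun i => y (.inl i)) ∈ orderedSolutions σ R (fun x => Q x ∧ P x) := by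
  have heq : orderedSolutions σ R (fun x => Q x ∧ P x) =
      orderedSolutions σ R (fun x => x e + x C = x f + x D ∧ P x) := by
    ext x
    refine and_congr_right fun h1 => and_congr_right fun h2 => and_congr_left fun h3 => ?_
    rw [hQ x ⟨h1, h2, trivial⟩]
    constructor <;> intro h <;> linarith
  rw [heq] at hne hef ⊢
  obtain ⟨σ', R'', h1, h2, h3⟩ := exists_twoSums_extension hne e f D C
    (fun x hx => (hef x hx).1) (fun x hx => by linarith [(hef x hx).2, hx.1.1 e]) 0
    (fun x hx => by rw [hx.2.2.1, sub_self, sign_zero]) P (fun x h => h.2)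
    (fun x h1 h2 => ⟨h1 rfl, h2⟩)
  exact ⟨σ', R'', h1, h2, h3.1⟩

/-- Eliminate one pending relation. -/
theorem exists_eliminate_relation {ι κ : Type} [Fintype κ] {σ : κ → κ → SignType}
    {R : List (ElemRel κ)} {P : (κ → ℝ) → Prop} (e f : ι → κ) (r : ElemRel ι)
    (hne : (orderedSolutions σ R (fun x => r.HoldsDiff e f x ∧ P x)).Nonempty)
    (hef : ∀ x ∈ orderedSolutions σ R (fun x => r.HoldsDiff e f x ∧ P x), ∀ i, x (e i) < x (f i)) :
    ∃ (τ : Type) (_ : Fintype τ) (j : κ → τ) (σ' : τ → τ → SignType) (R' : List (ElemRel τ)),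
      SE (orderedSolutions σ R (fun x => r.HoldsDiff e f x ∧ P x))
        (orderedSolutions σ' R' (fun y => P (fun i => y (j i)))) ∧
      (orderedSolutions σ' R' (fun y => P (fun i => y (j i)))).Nonempty ∧
      ∀ y ∈ orderedSolutions σ' R' (fun y => P (fun i => y (j i))), ∀ i,
        y (j (e i)) < y (j (f i)) := by
  have mono {κ : Type} {σ : κ → κ → SignType} {R : List (ElemRel κ)} {P : (κ → ℝ) → Prop}
      {x : κ → ℝ} (hx : x ∈ orderedSolutions σ R P) : x ∈ orderedSolutions σ R (fun _ => True) :=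
    orderedSolutions_mono (fun _ _ => trivial) hx
  cases r with
  | add i j k =>
    obtain ⟨σ₁, R₁, s₁, n₁, r₁, h₁⟩ := exists_twoSums_extension hne (e j) (f j) (f j) (f j)
      (fun x hx => hef x hx j) (fun x hx => by linarith [hx.1.1 (e j)]) (-1)
      (fun x hx => sign_neg (by linarith [hef x hx j])) _ (fun _ => id) (fun _ _ => id)
    obtain ⟨σ₂, R₂, s₂, n₂, r₂, h₂⟩ := exists_twoSums_extension n₁ (.inl (e i)) (.inl (f i))
      (.inr 2) (.inr 1)
      (fun x hx => hef _ (r₁ x hx) i)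
      (fun x hx => by linarith [hx.1.1 (.inl (e i)), (h₁ x (mono hx)).2.2 (f i) 1]) (-1)
      (fun x hx => sign_neg (by
        obtain ⟨-, ⟨h4, h5, -⟩, -⟩ := h₁ x (mono hx)
        rw [h4, h5]
        linarith [hef _ (r₁ x hx) i, hef _ (r₁ x hx) j])) _ (fun _ => id) (fun _ _ => id)
    obtain ⟨σ₃, R₃, s₃, n₃, r₃⟩ := exists_impose_difference
      (P := fun x => P (fun i => x (.inl (.inl i))))
      (Q := fun x => (ElemRel.add i j k).HoldsDiff e f (fun i => x (.inl (.inl i)))) n₂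
      (.inl (.inl (e k))) (.inl (.inl (f k))) (.inr 4) (.inr 3)
      (fun x hx => ⟨hef _ (r₁ _ (r₂ x hx)) k, (h₂ x (mono hx)).2.2 _ _⟩) (fun x hx => by
        obtain ⟨h3, ⟨-, -, h4, h5⟩, -⟩ := h₂ x hx
        obtain ⟨-, ⟨h6, h7, -⟩, -⟩ := h₁ _ h3
        rw [h4, h5, h6, h7, ElemRel.HoldsDiff, ElemRel.holds_add]
        constructor <;> intro h <;> linarith)
    exact ⟨_, inferInstance, fun i => .inl (.inl (.inl i)), σ₃, R₃, (s₁.trans s₂).trans s₃, n₃,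
      fun y hy i => hef _ (r₁ _ (r₂ _ (r₃ y hy))) i⟩
  | mul i j k =>
    obtain ⟨σ₁, R₁, s₁, n₁, r₁, h₁⟩ := exists_products_extension hne (e i) (f i) (e j) (f j)
      (fun x hx => hef x hx i) (fun x hx => hef x hx j)
    obtain ⟨σ₂, R₂, s₂, n₂, r₂, h₂⟩ := exists_twoSums_extension n₁ (.inr 3) (.inr 4)
      (.inr 5) (.inr 6)
      (fun x hx => by
        obtain ⟨-, ⟨h3, h4, -⟩, -⟩ := h₁ x (mono hx)
        rw [h3, h4]
        have h := hef _ (r₁ x hx) j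
        exact mul_lt_mul_of_pos_left (by linarith) (by linarith [hx.1.1 (.inl (e i))]))
      (fun x hx => by
        obtain ⟨-, ⟨-, h4, -, h6⟩, -⟩ := h₁ x (mono hx)
        have h := hef _ (r₁ x hx) i
        have h5 : x (.inr 4) < x (.inr 6) := by
          rw [h4, h6]
          exact mul_lt_mul_of_pos_right h
            (by linarith [hx.1.1 (.inr 0), hx.1.1 (.inl (f j))])
        linarith [hx.1.1 (.inr 3)]) 1
      (fun x hx => sign_pos (by
        obtain ⟨-, ⟨h3, h4, h5, h6⟩, -⟩ := h₁ x (mono hx)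
        rw [h3, h4, h5, h6]
        nlinarith [mul_pos (sub_pos.2 (hef _ (r₁ x hx) i)) (sub_pos.2 (hef _ (r₁ x hx) j))]))
      _ (fun _ => id) (fun _ _ => id)
    obtain ⟨σ₃, R₃, s₃, n₃, r₃⟩ := exists_impose_difference
      (P := fun x => P (fun i => x (.inl (.inl i))))
      (Q := fun x => (ElemRel.mul i j k).HoldsDiff e f (fun i => x (.inl (.inl i)))) n₂
      (.inl (.inl (e k))) (.inl (.inl (f k))) (.inr 3) (.inr 4)
      (fun x hx => ⟨hef _ (r₁ _ (r₂ x hx)) k, (h₂ x (mono hx)).2.2 _ _⟩) (fun x hx => by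
        obtain ⟨h3, ⟨-, -, h4, h5⟩, -⟩ := h₂ x hx
        obtain ⟨-, ⟨h6, h7, h8, h9⟩, -⟩ := h₁ _ h3
        rw [h4, h5, h6, h7, h8, h9, ElemRel.HoldsDiff, ElemRel.holds_mul]
        constructor <;> intro h <;> linarith)
    exact ⟨_, inferInstance, fun i => .inl (.inl (.inl i)), σ₃, R₃, (s₁.trans s₂).trans s₃, n₃,
      fun y hy i => hef _ (r₁ _ (r₂ _ (r₃ y hy))) i⟩

/-- Eliminate all pending relations. -/
theorem exists_eliminate_relations {ι : Type} (L : List (ElemRel ι)) :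
    ∀ {κ : Type} [Fintype κ] {σ : κ → κ → SignType} {R : List (ElemRel κ)} (e f : ι → κ),
      (orderedSolutions σ R (fun x => ∀ r ∈ L, r.HoldsDiff e f x)).Nonempty →
      (∀ x ∈ orderedSolutions σ R (fun x => ∀ r ∈ L, r.HoldsDiff e f x), ∀ i,
        x (e i) < x (f i)) →
      ∃ (τ : Type) (_ : Fintype τ) (σ' : τ → τ → SignType) (R' : List (ElemRel τ)),
        SE (orderedSolutions σ R (fun x => ∀ r ∈ L, r.HoldsDiff e f x))
          (orderedSolutions σ' R' (fun _ => True)) ∧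
        (orderedSolutions σ' R' (fun _ => True)).Nonempty := by
  induction L with
  | nil =>
    intro κ _ σ R e f hne _
    simp only [List.not_mem_nil, false_imp_iff, implies_true] at hne ⊢
    exact ⟨κ, inferInstance, σ, R, .refl _, hne⟩
  | cons r L ih =>
    intro κ _ σ R e f hne hef
    simp only [List.forall_mem_cons] at hne hef ⊢
    obtain ⟨τ, _, j, σ', R', h1, h2, h3⟩ := exists_eliminate_relation e f r hne hef
    obtain ⟨τ', _, σ'', R'', h4, h5⟩ := ih (fun i => j (e i)) (fun i => j (f i)) h2 h3
    exact ⟨τ', inferInstance, σ'', R'', h1.trans h4, h5⟩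

/-- The positive solution set of a list of relations is stably equivalent to the solution set of
an ordered system. -/
theorem exists_orderedSolutions {κ : Type} [Fintype κ] (L : List (ElemRel κ))
    (hne : (posSolutions L).Nonempty) :
    ∃ (τ : Type) (_ : Fintype τ) (σ : τ → τ → SignType) (R : List (ElemRel τ)),
      SE (posSolutions L) (orderedSolutions σ R (fun _ => True)) ∧
      (orderedSolutions σ R (fun _ => True)).Nonempty := by
  classical
  let ν : κ → ℝ := fun i => (Fintype.equivFin κ i : ℕ)
  have ν_inj : ∀ i j, i ≠ j → ν i + 1 ≤ ν j ∨ ν j + 1 ≤ ν i := by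
    intro i j hij
    have h : ((Fintype.equivFin κ i : Fin _) : ℕ) ≠ (Fintype.equivFin κ j : ℕ) := fun h =>
      hij ((Fintype.equivFin κ).injective (Fin.ext h))
    rcases lt_or_gt_of_ne h with h | h
    · exact Or.inl (by simp only [ν]; exact_mod_cast h)
    · exact Or.inr (by simp only [ν]; exact_mod_cast h)
  let base : κ ⊕ κ → ℝ := Sum.elim (fun i => 2 * ν i) (fun i => 2 * ν i + 1)
  let σ : κ ⊕ κ → κ ⊕ κ → SignType := fun p q => sign (base p - base q)
  let Φ : (κ → ℝ) → (κ → ℝ) → κ ⊕ κ → ℝ := fun z u => Sum.elim u (fun i => u i + z i)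
  let F : (κ ⊕ κ) ⊕ ((κ ⊕ κ) × (κ ⊕ κ)) → (κ → ℝ) → (κ → ℝ) → ℝ :=
    Sum.elim (fun p z u => Φ z u p - 1) (fun p z u => Φ z u p.1 - Φ z u p.2)
  let S : (κ ⊕ κ) ⊕ ((κ ⊕ κ) × (κ ⊕ κ)) → SignType :=
    Sum.elim (fun _ => 1) (fun p => σ p.1 p.2)
  let T := orderedSolutions σ [] (fun x => ∀ r ∈ L, r.HoldsDiff Sum.inl Sum.inr x)
  have hΦ : ∀ p, AffFn (fun z u => Φ z u p) := by
    rintro (i | i)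
    exacts [.coord i, (AffFn.coord i).add (.of_polyFn (.coord i))]
  have hF : ∀ k, AffFn (F k) := by
    rintro (p | ⟨p, q⟩)
    exacts [(hΦ p).sub (.of_polyFn (.const 1)), (hΦ p).sub (hΦ q)]
  have hne' : ∀ z ∈ posSolutions L, ∃ u, ∀ k, sign (F k z u) = S k := by
    rintro z ⟨hz, -⟩
    let B : ℝ := 2 + ∑ i, z i
    have hB : ∀ i, z i + 2 ≤ B := fun i => by
      have := Finset.single_le_sum (f := z) (fun j _ => (hz j).le) (Finset.mem_univ i)
      simp only [B]
      linarith
    have hν : ∀ i, 0 ≤ ν i := fun i => Nat.cast_nonneg _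
    let u : κ → ℝ := fun i => (ν i + 1) * B
    have gap : ∀ i j, ν i + 1 ≤ ν j → u i + z i + 1 ≤ u j := by
      intro i j h
      have h1 := hB i
      have h2 := hz i
      have h3 : (ν i + 1 + 1) * B ≤ (ν j + 1) * B :=
        mul_le_mul_of_nonneg_right (by linarith) (by linarith)
      simp only [u]
      linarith
    have hu : ∀ i, 1 < u i := fun i => by
      have := mul_nonneg (hν i) (by linarith [hB i, hz i] : (0 : ℝ) ≤ B)
      simp only [u]
      linarith [hB i, hz i]
    have lt_iff : ∀ p q, base p < base q → Φ z u p < Φ z u q := by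
      intro p q h
      rcases p with i | i <;> rcases q with j | j <;> simp only [base, Φ, Sum.elim_inl,
        Sum.elim_inr] at h ⊢ <;> rcases eq_or_ne i j with rfl | hij <;>
        first
        | exact absurd h (by linarith)
        | linarith [hz i]
        | rcases ν_inj i j hij with h' | h'
          · linarith [gap i j h', hz i, hz j]
          · linarith
    refine ⟨u, ?_⟩
    rintro (p | ⟨p, q⟩)
    · refine sign_pos (sub_pos.2 ?_)
      rcases p with i | i <;> simp only [Φ, Sum.elim_inl, Sum.elim_inr] <;>
        linarith [hu i, hz i]
    · rcases lt_trichotomy (base p) (base q) with h | h | h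
      · exact (sign_neg (sub_neg.2 (lt_iff p q h))).trans (sign_neg (sub_neg.2 h)).symm
      · have hpq : p = q := by
          rcases p with i | i <;> rcases q with j | j <;> simp only [base, Sum.elim_inl,
            Sum.elim_inr] at h <;> by_contra hne <;> rcases eq_or_ne i j with rfl | hij <;>
            first
            | exact hne rfl
            | linarith
            | rcases ν_inj i j hij with h' | h' <;> linarith
        simp [F, S, σ, hpq]
      · exact (sign_pos (sub_pos.2 (lt_iff q p h))).trans (sign_pos (sub_pos.2 h)).symm
  have hT : ∀ z ∈ posSolutions L, ∀ u, (∀ k, sign (F k z u) = S k) → Φ z u ∈ T := by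
    rintro z ⟨-, hz⟩ u hu
    refine ⟨⟨fun p => sub_pos.1 (sign_eq_one_iff.1 (hu (.inl p))), fun p q => hu (.inr (p, q))⟩,
      fun _ h => absurd h List.not_mem_nil, fun r hr => ?_⟩
    have : (fun i => Φ z u (.inr i) - Φ z u (.inl i)) = z := by
      funext i
      simp [Φ]
    rw [ElemRel.HoldsDiff, this]
    exact hz r hr
  have hlt : ∀ y ∈ T, ∀ i, y (.inl i) < y (.inr i) := by
    rintro y ⟨⟨-, hy⟩, -⟩ i
    refine sub_neg.1 (sign_eq_neg_one_iff.1 ((hy _ _).trans (sign_neg ?_)))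
    simp [base]
  have hTne : T.Nonempty := by
    obtain ⟨z, hz⟩ := hne
    obtain ⟨u, hu⟩ := hne' z hz
    exact ⟨_, hT z hz u hu⟩
  obtain ⟨τ, _, σ', R', h1, h2⟩ := exists_eliminate_relations L Sum.inl Sum.inr hTne hlt
  refine ⟨τ, inferInstance, σ', R', SE.trans ?_ h1, h2⟩
  refine SE.of_affine_polynomial F hF S hne' Φ (fun y i => y (.inr i) - y (.inl i))
    (fun y i => y (.inl i)) ?_ (fun i => (PolyFn.coord _).sub (.coord _)) (fun i => .coord _)
    (fun z hz u hu => ⟨hT z hz u hu, ?_, rfl⟩) (fun y hy => ?_)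
  · rintro (i | i)
    exacts [.coord _, (PolyFn.coord _).add (.coord _)]
  · funext i
    simp [Φ]
  · have hΦy : Φ (fun i => y (.inr i) - y (.inl i)) (fun i => y (.inl i)) = y := by
      funext p
      rcases p with i | i <;> simp [Φ]
    refine ⟨⟨fun i => sub_pos.2 (hlt y hy i), hy.2.2⟩, ?_, hΦy⟩
    rintro (p | ⟨p, q⟩)
    · change sign (Φ _ _ p - 1) = 1
      rw [hΦy]
      exact sign_pos (sub_pos.2 (hy.1.1 p))
    · change sign (Φ _ _ p - Φ _ _ q) = σ p q
      rw [hΦy]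
      exact hy.1.2 p q

/-! ### Planar point configurations with prescribed directions -/

/-- First coordinates of the directions `(1, 0)`, `(0, 1)`, `(1, 1)` and `(1, x i)`. -/
def dirX {κ : Type} : Fin 3 ⊕ κ → ℝ := Sum.elim ![1, 0, 1] (fun _ => 1)

/-- Second coordinates of the directions `(1, 0)`, `(0, 1)`, `(1, 1)` and `(1, x i)`. -/
def dirY {κ : Type} (x : κ → ℝ) : Fin 3 ⊕ κ → ℝ := Sum.elim ![0, 1, 1] x

/-- The determinant of a direction and the difference of two points. -/
def dirDet {κ α : Type} (x : κ → ℝ) (X Y : α → ℝ) (d : Fin 3 ⊕ κ) (a b : α) : ℝ :=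
  dirX d * (Y b - Y a) - dirY x d * (X b - X a)

/-- The orientation determinant of three points. -/
def orient {α : Type} (X Y : α → ℝ) (a b c : α) : ℝ :=
  (X b - X a) * (Y c - Y a) - (Y b - Y a) * (X c - X a)

/-- Points `(X a, Y a)` with prescribed orientations, also with respect to the directions of slopes
`0`, `∞`, `1` and `x i`; the slopes have order type `σ` and satisfy `P`, the point `o` is zero. -/
structure IsConfig {κ α : Type} (σ : κ → κ → SignType) (χ₁ : Fin 3 ⊕ κ → α → α → SignType)
    (χ₂ : α → α → α → SignType) (o : α) (P : (κ → ℝ) → Prop) (x : κ → ℝ) (X Y : α → ℝ) :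
    Prop where
  order : HasOrderType σ x
  pending : P x
  zeroX : X o = 0
  zeroY : Y o = 0
  sign_dirDet : ∀ d a b, sign (dirDet x X Y d a b) = χ₁ d a b
  sign_orient : ∀ a b c, sign (orient X Y a b c) = χ₂ a b c

/-- The set of configurations, as a set of coordinate vectors. -/
def configs {κ α : Type} (σ : κ → κ → SignType) (χ₁ : Fin 3 ⊕ κ → α → α → SignType)
    (χ₂ : α → α → α → SignType) (o : α) (P : (κ → ℝ) → Prop) : Set (κ ⊕ (α ⊕ α) → ℝ) :=
  {y | IsConfig σ χ₁ χ₂ o P (fun i => y (.inl i)) (fun a => y (.inr (.inl a)))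
    (fun a => y (.inr (.inr a)))}

theorem exists_sign_dirY {κ : Type} (σ : κ → κ → SignType) (d : Fin 3 ⊕ κ) :
    ∃ s, ∀ x, HasOrderType σ x → sign (dirY x d) = s := by
  rcases d with d | i
  · exact ⟨sign ((![0, 1, 1] : Fin 3 → ℝ) d), fun x _ => rfl⟩
  · exact ⟨1, fun x hx => sign_pos (zero_lt_one.trans (hx.1 i))⟩

theorem exists_sign_dir_det {κ : Type} (σ : κ → κ → SignType) (d e : Fin 3 ⊕ κ) :
    ∃ s, ∀ x, HasOrderType σ x → sign (dirX d * dirY x e - dirY x d * dirX e) = s := by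
  have key : ∀ (c : Fin 3) (i : κ), ∃ s, ∀ x, HasOrderType σ x →
      sign (dirX (.inl c : Fin 3 ⊕ κ) * dirY x (.inr i) - dirY x (.inl c) * dirX (.inr i)) = s := by
    intro c i
    fin_cases c
    · exact ⟨1, fun x hx => sign_pos (by simpa [dirX, dirY] using zero_lt_one.trans (hx.1 i))⟩
    · exact ⟨-1, fun x hx => sign_neg (by simp [dirX, dirY])⟩
    · exact ⟨1, fun x hx => sign_pos (by simpa [dirX, dirY] using hx.1 i)⟩
  rcases d with c | i <;> rcases e with c' | j
  · exact ⟨sign ((![1, 0, 1] : Fin 3 → ℝ) c * (![0, 1, 1] : Fin 3 → ℝ) c' -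
      (![0, 1, 1] : Fin 3 → ℝ) c * (![1, 0, 1] : Fin 3 → ℝ) c'), fun x _ => rfl⟩
  · exact key c j
  · obtain ⟨s, hs⟩ := key c' i
    refine ⟨-s, fun x hx => ?_⟩
    rw [← hs x hx, ← Left.sign_neg]
    congr 1
    ring
  · exact ⟨σ j i, fun x hx => by simpa [dirX, dirY] using hx.2 j i⟩

theorem eventually_sign_linear (c₁ c₀ : ℝ) (h : c₁ ≠ 0) :
    ∀ᶠ t : ℝ in atTop, sign (c₁ * t + c₀) = sign c₁ := by
  have key : ∀ c₁ c₀ : ℝ, 0 < c₁ → ∀ᶠ t : ℝ in atTop, 0 < c₁ * t + c₀ := fun c₁ c₀ h =>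
    (tendsto_atTop_add_const_right atTop c₀ (tendsto_id.const_mul_atTop h)).eventually_gt_atTop 0
  rcases h.lt_or_gt with h | h
  · refine (key (-c₁) (-c₀) (neg_pos.2 h)).mono fun t ht => ?_
    rw [sign_neg h]
    exact sign_neg (by linarith)
  · refine (key c₁ c₀ h).mono fun t ht => ?_
    rw [sign_pos h, sign_pos ht]

theorem eventually_sign_quadratic (c₂ c₁ c₀ : ℝ) (h : c₂ ≠ 0) :
    ∀ᶠ t : ℝ in atTop, sign (c₂ * t ^ 2 + c₁ * t + c₀) = sign c₂ := by
  have key : ∀ c₂ c₁ c₀ : ℝ, 0 < c₂ → ∀ᶠ t : ℝ in atTop, 0 < c₂ * t ^ 2 + c₁ * t + c₀ := by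
    intro c₂ c₁ c₀ h
    have h1 := tendsto_atTop_add_const_right atTop c₁ (tendsto_id.const_mul_atTop h)
    have h2 := tendsto_atTop_add_const_right atTop c₀ (tendsto_id.atTop_mul_atTop₀ h1)
    refine (h2.eventually_gt_atTop 0).mono fun t ht => ?_
    simp only [id] at ht
    linarith
  rcases h.lt_or_gt with h | h
  · refine (key (-c₂) (-c₁) (-c₀) (neg_pos.2 h)).mono fun t ht => ?_
    rw [sign_neg h]
    exact sign_neg (by linarith)
  · refine (key c₂ c₁ c₀ h).mono fun t ht => ?_
    rw [sign_pos h, sign_pos ht]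

theorem exists_eventually_sign_quadratic {Z : Type} (c₂ c₁ c₀ : Z → ℝ)
    (h₂ : ∃ s, ∀ z, sign (c₂ z) = s) (h₁ : ∃ s, ∀ z, sign (c₁ z) = s)
    (h₀ : ∃ s, ∀ z, c₂ z = 0 → c₁ z = 0 → sign (c₀ z) = s) :
    ∃ s, ∀ z, ∀ᶠ t : ℝ in atTop, sign (c₂ z * t ^ 2 + c₁ z * t + c₀ z) = s := by
  obtain ⟨s₂, h₂⟩ := h₂
  obtain ⟨s₁, h₁⟩ := h₁
  obtain ⟨s₀, h₀⟩ := h₀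
  by_cases e₂ : s₂ = 0
  · have z₂ : ∀ z, c₂ z = 0 := fun z => sign_eq_zero_iff.1 ((h₂ z).trans e₂)
    by_cases e₁ : s₁ = 0
    · have z₁ : ∀ z, c₁ z = 0 := fun z => sign_eq_zero_iff.1 ((h₁ z).trans e₁)
      exact ⟨s₀, fun z => .of_forall fun t => by simp [z₁ z, z₂ z, h₀ z]⟩
    · refine ⟨s₁, fun z => ?_⟩
      have : c₁ z ≠ 0 := fun h => e₁ (by rw [← h₁ z, h, sign_zero])
      filter_upwards [eventually_sign_linear _ (c₀ z) this] with t ht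
      rw [z₂ z, ← h₁ z, ← ht]
      congr 1
      ring
  · refine ⟨s₂, fun z => ?_⟩
    have : c₂ z ≠ 0 := fun h => e₂ (by rw [← h₂ z, h, sign_zero])
    rw [← h₂ z]
    exact eventually_sign_quadratic _ _ _ this

/-- Up to a positive factor, `H` is affine in the fiber coordinates, and its sign is eventually
constant along the curve `(t, t ^ 2, 1)`. -/
def Tame {ι : Type} (Z : Set (ι → ℝ)) (H : (ι → ℝ) → (Fin 3 → ℝ) → ℝ) : Prop :=
  ∃ G : (ι → ℝ) → (Fin 3 → ℝ) → ℝ, AffFn G ∧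
    (∀ y ∈ Z, ∀ u, 0 < u 2 → sign (H y u) = sign (G y u)) ∧
    ∃ s, ∀ y ∈ Z, ∀ᶠ t : ℝ in atTop, sign (G y ![t, t ^ 2, 1]) = s

namespace Tame

variable {ι : Type} {Z : Set (ι → ℝ)} {H H' : (ι → ℝ) → (Fin 3 → ℝ) → ℝ}

theorem neg (h : Tame Z H) (h' : ∀ y u, H' y u = -H y u) : Tame Z H' := by
  obtain ⟨G, h1, h2, s, h3⟩ := h
  refine ⟨fun y u => -1 * G y u, .polyFn_mul (.const (-1)) h1, fun y hy u hu => ?_, -s,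
    fun y hy => ?_⟩
  · simp only [h', neg_one_mul, Left.sign_neg, h2 y hy u hu]
  · filter_upwards [h3 y hy] with t ht
    simp only [neg_one_mul, Left.sign_neg, ht]

theorem of_polyFn (g : (ι → ℝ) → ℝ) (hg : PolyFn g) (hs : ∃ s, ∀ y ∈ Z, sign (g y) = s)
    (h : ∀ y ∈ Z, ∀ u, 0 < u 2 → ∃ r, 0 < r ∧ H y u = r * g y) : Tame Z H := by
  obtain ⟨s, hs⟩ := hs
  refine ⟨fun y _ => g y, .of_polyFn hg, fun y hy u hu => ?_, s, fun y hy => .of_forall fun _ =>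
    hs y hy⟩
  obtain ⟨r, hr, h⟩ := h y hy u hu
  rw [h, sign_mul, sign_pos hr, one_mul]

/-- Determinants of a vector with the difference of a fixed point and a moving point. -/
theorem of_det (v₁ v₂ a₁ a₂ b₁ b₂ : (ι → ℝ) → ℝ) (hv₁ : PolyFn v₁) (hv₂ : PolyFn v₂)
    (ha₁ : PolyFn a₁) (ha₂ : PolyFn a₂) (hb₁ : PolyFn b₁) (hb₂ : PolyFn b₂)
    (hs₁ : ∃ s, ∀ y ∈ Z, sign (v₁ y) = s) (hs₂ : ∃ s, ∀ y ∈ Z, sign (v₂ y) = s)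
    (h : ∀ y ∈ Z, ∀ u, 0 < u 2 → ∃ r, 0 < r ∧ H y u =
      r * (v₁ y * (u 1 + u 2 * b₂ y - a₂ y) - v₂ y * (u 0 + u 2 * b₁ y - a₁ y))) : Tame Z H := by
  obtain ⟨s, hs⟩ := exists_eventually_sign_quadratic (Z := Z) (fun z => v₁ z) (fun z => -v₂ z)
    (fun z => v₁ z * (b₂ z - a₂ z) - v₂ z * (b₁ z - a₁ z))
    (by obtain ⟨s, h⟩ := hs₁; exact ⟨s, fun z => h z z.2⟩)
    (by obtain ⟨s, h⟩ := hs₂; exact ⟨-s, fun z => by rw [Left.sign_neg, h z z.2]⟩)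
    ⟨0, fun z h1 h2 => by simp [h1, neg_eq_zero.1 h2]⟩
  refine ⟨fun y u => v₁ y * (u 1 + b₂ y * u 2 - a₂ y) - v₂ y * (u 0 + b₁ y * u 2 - a₁ y),
    ?_, fun y hy u hu => ?_, s, fun y hy => ?_⟩
  · exact (AffFn.polyFn_mul hv₁ (((AffFn.coord 1).add (.polyFn_mul hb₂ (.coord 2))).sub
      (.of_polyFn ha₂))).sub (AffFn.polyFn_mul hv₂ (((AffFn.coord 0).add
      (.polyFn_mul hb₁ (.coord 2))).sub (.of_polyFn ha₁)))
  · obtain ⟨r, hr, h⟩ := h y hy u hu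
    rw [h, sign_mul, sign_pos hr, one_mul]
    congr 1
    ring
  · filter_upwards [hs ⟨y, hy⟩] with t ht
    rw [← ht]
    congr 1
    simp
    ring

end Tame

/-- Coordinates after adding four points. -/
def gadgetCoord {κ α : Type} (A : Fin 4 → (κ → ℝ) → ℝ) (x : κ → ℝ) (X : α → ℝ) (p s : ℝ) :
    α ⊕ Fin 4 → ℝ :=
  Sum.elim X (fun c => p + s * A c x)

theorem exists_sign_scaled {κ : Type} {σ : κ → κ → SignType} {P : (κ → ℝ) → Prop}
    {A B : Fin 4 → (κ → ℝ) → ℝ} {δ : Fin 4 → Fin 4 → Fin 3 ⊕ κ}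
    (hδ : ∀ c c', c < c' → ∃ s, ∀ x, HasOrderType σ x → P x → ∃ μ : ℝ, sign μ = s ∧
      A c' x - A c x = μ * dirX (δ c c') ∧ B c' x - B c x = μ * dirY x (δ c c')) (c c' : Fin 4) :
    ∃ s d, ∀ x, HasOrderType σ x → P x → ∃ μ : ℝ, sign μ = s ∧
      A c' x - A c x = μ * dirX d ∧ B c' x - B c x = μ * dirY x d := by
  rcases lt_trichotomy c c' with h | rfl | h
  · obtain ⟨s, hs⟩ := hδ c c' h
    exact ⟨s, _, hs⟩
  · exact ⟨0, .inl 0, fun x _ _ => ⟨0, by simp⟩⟩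
  · obtain ⟨s, hs⟩ := hδ c' c h
    refine ⟨-s, δ c' c, fun x hx hP => ?_⟩
    obtain ⟨μ, h1, h2, h3⟩ := hs x hx hP
    exact ⟨-μ, by rw [Left.sign_neg, h1], by linarith, by linarith⟩

/-- Add four points, whose connecting lines have given directions, to a configuration. -/
theorem exists_gadget {κ α : Type} [Fintype κ] [Fintype α] {σ : κ → κ → SignType}
    {χ₁ : Fin 3 ⊕ κ → α → α → SignType} {χ₂ : α → α → α → SignType} {o : α}
    {P : (κ → ℝ) → Prop} (hne : (configs σ χ₁ χ₂ o P).Nonempty) (A B : Fin 4 → (κ → ℝ) → ℝ)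
    (hA : ∀ c, PolyFn (A c)) (hB : ∀ c, PolyFn (B c))
    (h0 : ∀ x, A 0 x = 0 ∧ B 0 x = 0 ∧ A 1 x = 1) (δ : Fin 4 → Fin 4 → Fin 3 ⊕ κ)
    (hδ : ∀ c c', c < c' → ∃ s, ∀ x, HasOrderType σ x → P x → ∃ μ : ℝ, sign μ = s ∧
      A c' x - A c x = μ * dirX (δ c c') ∧ B c' x - B c x = μ * dirY x (δ c c'))
    (P' : (κ → ℝ) → Prop) (hP : ∀ x, P x → P' x)
    (hP' : ∀ x, HasOrderType σ x → P' x → ∀ q₁ q₂ : Fin 4 → ℝ, q₁ 0 < q₁ 1 →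
      (∀ c c', c < c' →
        dirX (δ c c') * (q₂ c' - q₂ c) = dirY x (δ c c') * (q₁ c' - q₁ c)) →
      P x ∧ ∀ c, q₁ c = q₁ 0 + (q₁ 1 - q₁ 0) * A c x ∧ q₂ c = q₂ 0 + (q₁ 1 - q₁ 0) * B c x) :
    ∃ (χ₁' : Fin 3 ⊕ κ → α ⊕ Fin 4 → α ⊕ Fin 4 → SignType)
      (χ₂' : α ⊕ Fin 4 → α ⊕ Fin 4 → α ⊕ Fin 4 → SignType),
      SE (configs σ χ₁ χ₂ o P) (configs σ χ₁' χ₂' (.inl o) P') ∧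
      (configs σ χ₁' χ₂' (.inl o) P').Nonempty := by
  set Z := configs σ χ₁ χ₂ o P with hZ
  have hδ' := exists_sign_scaled hδ
  let x : (κ ⊕ (α ⊕ α) → ℝ) → κ → ℝ := fun y i => y (.inl i)
  let X : (κ ⊕ (α ⊕ α) → ℝ) → α → ℝ := fun y a => y (.inr (.inl a))
  let Y : (κ ⊕ (α ⊕ α) → ℝ) → α → ℝ := fun y a => y (.inr (.inr a))
  let X' : (κ ⊕ (α ⊕ α) → ℝ) → (Fin 3 → ℝ) → α ⊕ Fin 4 → ℝ := fun y u =>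
    gadgetCoord A (x y) (X y) (u 0) (u 2)
  let Y' : (κ ⊕ (α ⊕ α) → ℝ) → (Fin 3 → ℝ) → α ⊕ Fin 4 → ℝ := fun y u =>
    gadgetCoord B (x y) (Y y) (u 1) (u 2)
  have pX : ∀ a, PolyFn (fun y => X y a) := fun a => .coord _
  have pY : ∀ a, PolyFn (fun y => Y y a) := fun a => .coord _
  have pA : ∀ c, PolyFn (fun y => A c (x y)) := fun c => (hA c).comp_reindex _
  have pB : ∀ c, PolyFn (fun y => B c (x y)) := fun c => (hB c).comp_reindex _
  have pdY : ∀ d, PolyFn (fun y => dirY (x y) d) := by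
    rintro (d | i)
    exacts [.const _, .coord _]
  have sdX : ∀ d : Fin 3 ⊕ κ, ∃ s, ∀ y ∈ Z, sign (dirX d) = s := fun d => ⟨_, fun _ _ => rfl⟩
  have sdY : ∀ d : Fin 3 ⊕ κ, ∃ s, ∀ y ∈ Z, sign (dirY (x y) d) = s := fun d => by
    obtain ⟨s, hs⟩ := exists_sign_dirY σ d
    exact ⟨s, fun y hy => hs _ hy.order⟩
  have sX : ∀ a b, ∃ s, ∀ y ∈ Z, sign (X y b - X y a) = s := fun a b =>
    ⟨χ₁ (.inl 1) b a, fun y hy => by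
      rw [← hy.sign_dirDet (.inl 1) b a]
      congr 1
      simp [dirDet, dirX, dirY, X]⟩
  have sY : ∀ a b, ∃ s, ∀ y ∈ Z, sign (Y y b - Y y a) = s := fun a b =>
    ⟨χ₁ (.inl 0) a b, fun y hy => by
      rw [← hy.sign_dirDet (.inl 0) a b]
      congr 1
      simp [dirDet, dirX, dirY, Y]⟩
  have sA : ∀ c c', ∃ s, ∀ y ∈ Z, sign (A c' (x y) - A c (x y)) = s := by
    intro c c'
    obtain ⟨s, d, h⟩ := hδ' c c'
    refine ⟨s * sign (dirX d), fun y hy => ?_⟩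
    obtain ⟨μ, h1, h2, -⟩ := h _ hy.order hy.pending
    rw [h2, sign_mul, h1]
  have sB : ∀ c c', ∃ s, ∀ y ∈ Z, sign (B c' (x y) - B c (x y)) = s := by
    intro c c'
    obtain ⟨s, d, h⟩ := hδ' c c'
    obtain ⟨s', h'⟩ := sdY d
    refine ⟨s * s', fun y hy => ?_⟩
    obtain ⟨μ, h1, -, h2⟩ := h _ hy.order hy.pending
    rw [h2, sign_mul, h1, h' y hy]
  have tame₁ : ∀ d a b, Tame Z (fun y u => dirDet (x y) (X' y u) (Y' y u) d a b) := by
    have mixed : ∀ d a c,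
        Tame Z (fun y u => dirDet (x y) (X' y u) (Y' y u) d (.inl a) (.inr c)) := fun d a c =>
      .of_det (fun _ => dirX d) (fun y => dirY (x y) d) (fun y => X y a) (fun y => Y y a)
        (fun y => A c (x y)) (fun y => B c (x y)) (.const _) (pdY d) (pX a) (pY a) (pA c) (pB c)
        (sdX d) (sdY d) (fun y hy u hu => ⟨1, one_pos, by rw [one_mul]; rfl⟩)
    rintro d (a | c) (b | c')
    · refine .of_polyFn (fun y => dirDet (x y) (X y) (Y y) d a b) ?_ ⟨_, fun y hy =>
        hy.sign_dirDet d a b⟩ (fun y hy u hu => ⟨1, one_pos, (one_mul _).symm⟩)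
      exact ((PolyFn.const _).mul ((pY b).sub (pY a))).sub ((pdY d).mul ((pX b).sub (pX a)))
    · exact mixed d a c'
    · refine (mixed d b c).neg fun y u => ?_
      simp only [dirDet]
      ring
    · refine .of_polyFn (fun y => dirX d * (B c' (x y) - B c (x y)) -
        dirY (x y) d * (A c' (x y) - A c (x y)))
        (((PolyFn.const _).mul ((pB c').sub (pB c))).sub ((pdY d).mul ((pA c').sub (pA c)))) ?_ ?_
      · obtain ⟨s, e, h⟩ := hδ' c c'
        obtain ⟨s', h'⟩ := exists_sign_dir_det σ d e
        refine ⟨s * s', fun y hy => ?_⟩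
        obtain ⟨μ, h1, h2, h3⟩ := h _ hy.order hy.pending
        rw [h2, h3, ← h1, ← h' _ hy.order, ← sign_mul]
        congr 1
        ring
      · intro y hy u hu
        refine ⟨u 2, hu, ?_⟩
        simp only [dirDet, X', Y', gadgetCoord, Sum.elim_inr]
        ring
  have tame₂ : ∀ a b c, Tame Z (fun y u => orient (X' y u) (Y' y u) a b c) := by
    have swap₁ : ∀ a b c, Tame Z (fun y u => orient (X' y u) (Y' y u) a b c) →
        Tame Z (fun y u => orient (X' y u) (Y' y u) b a c) := fun a b c h => h.neg fun y u => by
      simp only [orient]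
      ring
    have swap₂ : ∀ a b c, Tame Z (fun y u => orient (X' y u) (Y' y u) a b c) →
        Tame Z (fun y u => orient (X' y u) (Y' y u) a c b) := fun a b c h => h.neg fun y u => by
      simp only [orient]
      ring
    have oon : ∀ a b c,
        Tame Z (fun y u => orient (X' y u) (Y' y u) (.inl a) (.inl b) (.inr c)) := fun a b c =>
      .of_det (fun y => X y b - X y a) (fun y => Y y b - Y y a) (fun y => X y a) (fun y => Y y a)
        (fun y => A c (x y)) (fun y => B c (x y)) ((pX b).sub (pX a)) ((pY b).sub (pY a))
        (pX a) (pY a) (pA c) (pB c) (sX a b) (sY a b)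
        (fun y hy u hu => ⟨1, one_pos, by rw [one_mul]; rfl⟩)
    have onn : ∀ a c c',
        Tame Z (fun y u => orient (X' y u) (Y' y u) (.inl a) (.inr c) (.inr c')) := by
      intro a c c'
      refine .of_det (fun y => A c (x y) - A c' (x y)) (fun y => B c (x y) - B c' (x y))
        (fun y => X y a) (fun y => Y y a)
        (fun y => A c (x y)) (fun y => B c (x y)) ((pA c).sub (pA c')) ((pB c).sub (pB c'))
        (pX a) (pY a) (pA c) (pB c) (sA c' c) (sB c' c) (fun y hy u hu => ⟨u 2, hu, ?_⟩)
      simp only [orient, X', Y', gadgetCoord, Sum.elim_inr, Sum.elim_inl]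
      ring
    rintro (a | a) (b | b) (c | c)
    · refine .of_polyFn (fun y => orient (X y) (Y y) a b c) ?_ ⟨_, fun y hy =>
        hy.sign_orient a b c⟩ (fun y hy u hu => ⟨1, one_pos, (one_mul _).symm⟩)
      exact (((pX b).sub (pX a)).mul ((pY c).sub (pY a))).sub
        (((pY b).sub (pY a)).mul ((pX c).sub (pX a)))
    · exact oon a b c
    · exact swap₂ _ _ _ (oon a c b)
    · exact onn a b c
    · exact swap₁ _ _ _ (swap₂ _ _ _ (oon b c a))
    · exact swap₁ _ _ _ (onn b a c)
    · exact swap₂ _ _ _ (swap₁ _ _ _ (onn c a b))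
    · refine .of_polyFn (fun y => (A b (x y) - A a (x y)) * (B c (x y) - B a (x y)) -
        (B b (x y) - B a (x y)) * (A c (x y) - A a (x y)))
        ((((pA b).sub (pA a)).mul ((pB c).sub (pB a))).sub
          (((pB b).sub (pB a)).mul ((pA c).sub (pA a)))) ?_ ?_
      · obtain ⟨s, e, h⟩ := hδ' a b
        obtain ⟨s', e', h'⟩ := hδ' a c
        obtain ⟨s'', h''⟩ := exists_sign_dir_det σ e e'
        refine ⟨s * s' * s'', fun y hy => ?_⟩
        obtain ⟨μ, h1, h2, h3⟩ := h _ hy.order hy.pending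
        obtain ⟨μ', h4, h5, h6⟩ := h' _ hy.order hy.pending
        rw [h2, h3, h5, h6, ← h1, ← h4, ← h'' _ hy.order, ← sign_mul, ← sign_mul]
        congr 1
        ring
      · intro y hy u hu
        refine ⟨u 2 * u 2, mul_pos hu hu, ?_⟩
        simp only [orient, X', Y', gadgetCoord, Sum.elim_inr]
        ring
  choose G₁ aff₁ eq₁ s₁ ev₁ using tame₁
  choose G₂ aff₂ eq₂ s₂ ev₂ using tame₂
  let D := Fin 3 ⊕ κ
  let β := α ⊕ Fin 4
  let K := Unit ⊕ ((D × β × β) ⊕ (β × β × β))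
  let F : K → (κ ⊕ (α ⊕ α) → ℝ) → (Fin 3 → ℝ) → ℝ :=
    Sum.elim (fun _ _ u => u 2) (Sum.elim (fun p => G₁ p.1 p.2.1 p.2.2)
      (fun p => G₂ p.1 p.2.1 p.2.2))
  let S : K → SignType :=
    Sum.elim (fun _ => 1) (Sum.elim (fun p => s₁ p.1 p.2.1 p.2.2) (fun p => s₂ p.1 p.2.1 p.2.2))
  let T := configs σ s₁ s₂ (.inl o : β) P'
  have hF : ∀ k, AffFn (F k) := by
    rintro (k | k | k)
    exacts [.coord 2, aff₁ _ _ _, aff₂ _ _ _]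
  have hne' : ∀ y ∈ Z, ∃ u, ∀ k, sign (F k y u) = S k := by
    intro y hy
    have h1 : ∀ᶠ t : ℝ in atTop, ∀ k, sign (F k y ![t, t ^ 2, 1]) = S k := by
      rw [eventually_all]
      rintro (k | k | k)
      exacts [.of_forall fun t => by simp [F, S], ev₁ _ _ _ y hy, ev₂ _ _ _ y hy]
    obtain ⟨t, ht⟩ := h1.exists
    exact ⟨_, ht⟩
  let Φ : (κ ⊕ (α ⊕ α) → ℝ) → (Fin 3 → ℝ) → κ ⊕ (β ⊕ β) → ℝ := fun y u =>
    Sum.elim (x y) (Sum.elim (X' y u) (Y' y u))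
  have hT : ∀ y ∈ Z, ∀ u, (∀ k, sign (F k y u) = S k) → Φ y u ∈ T := by
    intro y hy u hu
    have hu0 : 0 < u 2 := sign_eq_one_iff.1 (hu (.inl ()))
    exact ⟨hy.order, hP _ hy.pending, hy.zeroX, hy.zeroY,
      fun d a b => (eq₁ d a b y hy u hu0).trans (hu (.inr (.inl (d, a, b)))),
      fun a b c => (eq₂ a b c y hy u hu0).trans (hu (.inr (.inr (a, b, c))))⟩
  obtain ⟨y₀, hy₀⟩ := hne
  obtain ⟨u₀, hu₀⟩ := hne' y₀ hy₀
  have hu0 : 0 < u₀ 2 := sign_eq_one_iff.1 (hu₀ (.inl ()))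
  have hT₀ := hT y₀ hy₀ u₀ hu₀
  let g₁ : (κ ⊕ (β ⊕ β) → ℝ) → κ ⊕ (α ⊕ α) → ℝ := fun w => fun i => w (Sum.map id
    (Sum.map Sum.inl Sum.inl) i)
  let g₂ : (κ ⊕ (β ⊕ β) → ℝ) → Fin 3 → ℝ := fun w => ![w (.inr (.inl (.inr 0))),
    w (.inr (.inr (.inr 0))), w (.inr (.inl (.inr 1))) - w (.inr (.inl (.inr 0)))]
  have back : ∀ w ∈ T, g₁ w ∈ Z ∧ 0 < g₂ w 2 ∧ Φ (g₁ w) (g₂ w) = w := by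
    intro w hw
    let q₁ : Fin 4 → ℝ := fun c => w (.inr (.inl (.inr c)))
    let q₂ : Fin 4 → ℝ := fun c => w (.inr (.inr (.inr c)))
    have hq : q₁ 0 < q₁ 1 := by
      have h1 := (hw.sign_dirDet (.inl 1) (.inr 0) (.inr 1)).trans
        (hT₀.sign_dirDet (.inl 1) (.inr 0) (.inr 1)).symm
      obtain ⟨h2, h3, h4⟩ := h0 (x y₀)
      have h5 : dirDet (x y₀) (X' y₀ u₀) (Y' y₀ u₀) (.inl 1) (.inr 0) (.inr 1) = -u₀ 2 := by
        simp [dirDet, dirX, dirY, X', Y', gadgetCoord, h2, h4]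
      rw [show sign (dirDet (fun i => Φ y₀ u₀ (.inl i)) (fun a => Φ y₀ u₀ (.inr (.inl a)))
        (fun a => Φ y₀ u₀ (.inr (.inr a))) (.inl 1) (.inr 0) (.inr 1)) = sign (-u₀ 2) from
        congrArg sign h5, sign_neg (neg_neg_of_pos hu0), sign_eq_neg_one_iff] at h1
      simpa [dirDet, dirX, dirY] using h1
    obtain ⟨h1, h2⟩ := hP' (fun i => w (.inl i)) hw.order hw.pending q₁ q₂ hq (by
      intro c c' hcc
      have h1 := (hw.sign_dirDet (δ c c') (.inr c) (.inr c')).trans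
        (hT₀.sign_dirDet (δ c c') (.inr c) (.inr c')).symm
      obtain ⟨s, h⟩ := hδ c c' hcc
      obtain ⟨μ, h3, h4, h5⟩ := h _ hy₀.order hy₀.pending
      have h6 : dirDet (x y₀) (X' y₀ u₀) (Y' y₀ u₀) (δ c c') (.inr c) (.inr c') = 0 := by
        have h7 : B c' (x y₀) = B c (x y₀) + μ * dirY (x y₀) (δ c c') := by linarith
        have h8 : A c' (x y₀) = A c (x y₀) + μ * dirX (δ c c') := by linarith
        simp only [dirDet, X', Y', gadgetCoord, Sum.elim_inr, h7, h8]
        ring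
      rw [show sign (dirDet (fun i => Φ y₀ u₀ (.inl i)) (fun a => Φ y₀ u₀ (.inr (.inl a)))
        (fun a => Φ y₀ u₀ (.inr (.inr a))) (δ c c') (.inr c) (.inr c')) = sign (0 : ℝ) from
        congrArg sign h6, sign_zero, sign_eq_zero_iff, dirDet, sub_eq_zero] at h1
      exact h1)
    refine ⟨⟨hw.order, h1, hw.zeroX, hw.zeroY, fun d a b => ?_, fun a b c => ?_⟩, ?_, ?_⟩
    · exact ((hw.sign_dirDet d (.inl a) (.inl b)).trans
        (hT₀.sign_dirDet d (.inl a) (.inl b)).symm).trans (hy₀.sign_dirDet d a b)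
    · exact ((hw.sign_orient (.inl a) (.inl b) (.inl c)).trans
        (hT₀.sign_orient (.inl a) (.inl b) (.inl c)).symm).trans (hy₀.sign_orient a b c)
    · exact sub_pos.2 hq
    · funext i
      rcases i with i | (a | c) | (a | c)
      exacts [rfl, rfl, (h2 c).1.symm, rfl, (h2 c).2.symm]
  refine ⟨s₁, s₂, ?_, ⟨_, hT₀⟩⟩
  refine SE.of_affine_polynomial F hF S hne' Φ g₁ g₂ ?_ (fun i => .coord _) ?_
    (fun y hy u hu => ⟨hT y hy u hu, ?_, ?_⟩) (fun w hw => ?_)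
  · rintro (i | (a | c) | (a | c))
    · exact .coord _
    · exact .coord _
    · exact (PolyFn.coord (.inr (0 : Fin 3))).add ((PolyFn.coord (.inr (2 : Fin 3))).mul
        ((pA c).comp_reindex Sum.inl))
    · exact .coord _
    · exact (PolyFn.coord (.inr (1 : Fin 3))).add ((PolyFn.coord (.inr (2 : Fin 3))).mul
        ((pB c).comp_reindex Sum.inl))
  · intro j
    fin_cases j
    exacts [.coord _, .coord _, (PolyFn.coord _).sub (.coord _)]
  · funext i
    rcases i with i | a | a <;> rfl
  · obtain ⟨h2, h3, h4⟩ := h0 (x y)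
    funext j
    fin_cases j <;> simp [g₂, Φ, X', Y', gadgetCoord, h2, h3, h4]
  · obtain ⟨h1, h2, h3⟩ := back w hw
    refine ⟨h1, ?_, h3⟩
    have h4 : ∀ i, Φ (g₁ w) (g₂ w) i = w i := congrFun h3
    rw [← h3] at hw
    rintro (k | ⟨d, a, b⟩ | ⟨a, b, c⟩)
    · exact sign_pos h2
    · exact (eq₁ d a b _ h1 _ h2).symm.trans (hw.sign_dirDet d a b)
    · exact (eq₂ a b c _ h1 _ h2).symm.trans (hw.sign_orient a b c)

theorem forall_lt_fin_four (Q : Fin 4 → Fin 4 → Prop) : (∀ c c', c < c' → Q c c') ↔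
    Q 0 1 ∧ Q 0 2 ∧ Q 0 3 ∧ Q 1 2 ∧ Q 1 3 ∧ Q 2 3 := by
  constructor
  · intro h
    exact ⟨h _ _ (by decide), h _ _ (by decide), h _ _ (by decide), h _ _ (by decide),
      h _ _ (by decide), h _ _ (by decide)⟩
  · rintro ⟨h1, h2, h3, h4, h5, h6⟩ c c' hc
    fin_cases c <;> fin_cases c' <;> first | assumption | exact absurd hc (by decide)

/-- Enforce a relation between the slopes by adding four points to a configuration. -/
theorem exists_gadget_of_elemRel {κ α : Type} [Fintype κ] [Fintype α] {σ : κ → κ → SignType}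
    {χ₁ : Fin 3 ⊕ κ → α → α → SignType} {χ₂ : α → α → α → SignType} {o : α}
    (r : ElemRel κ) (P : (κ → ℝ) → Prop)
    (hne : (configs σ χ₁ χ₂ o (fun x => r.Holds x ∧ P x)).Nonempty) :
    ∃ (χ₁' : Fin 3 ⊕ κ → α ⊕ Fin 4 → α ⊕ Fin 4 → SignType)
      (χ₂' : α ⊕ Fin 4 → α ⊕ Fin 4 → α ⊕ Fin 4 → SignType),
      SE (configs σ χ₁ χ₂ o (fun x => r.Holds x ∧ P x)) (configs σ χ₁' χ₂' (.inl o) P) ∧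
      (configs σ χ₁' χ₂' (.inl o) P).Nonempty := by
  rcases r with ⟨i, j, k⟩ | ⟨i, j, k⟩
  · refine exists_gadget hne ![fun _ => 0, fun _ => 1, fun _ => 0, fun _ => 1]
      ![fun _ => 0, fun x => x i, fun x => x i, fun x => x i + x j] ?_ ?_ (fun x => by simp)
      ![![.inl 0, .inr i, .inl 1, .inr k], ![.inl 0, .inl 0, .inl 0, .inl 1],
        ![.inl 0, .inl 0, .inl 0, .inr j], ![.inl 0, .inl 0, .inl 0, .inl 0]] ?_ P
      (fun x h => h.2) ?_
    · intro c
      fin_cases c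
      exacts [.const _, .const _, .const _, .const _]
    · intro c
      fin_cases c
      exacts [.const _, .coord _, .coord _, (PolyFn.coord _).add (.coord _)]
    · rw [forall_lt_fin_four]
      refine ⟨⟨1, fun x hx h => ⟨1, ?_⟩⟩, ⟨1, fun x hx h => ⟨x i, ?_⟩⟩,
        ⟨1, fun x hx h => ⟨1, ?_⟩⟩, ⟨-1, fun x hx h => ⟨-1, ?_⟩⟩, ⟨1, fun x hx h => ⟨x j, ?_⟩⟩,
        ⟨1, fun x hx h => ⟨1, ?_⟩⟩⟩ <;>
        have hi := zero_lt_one.trans (hx.1 i) <;> have hj := zero_lt_one.trans (hx.1 j) <;>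
        have hk := (ElemRel.holds_add i j k x).1 h.1 <;> simp [dirX, dirY, hi, hj, ← hk]
    · intro x hx hP q₁ q₂ hq
      rw [forall_lt_fin_four]
      simp only [dirX, dirY, Matrix.cons_val, Sum.elim_inl, Sum.elim_inr, one_mul, zero_mul]
      rintro ⟨h01, h02, h03, h12, h13, h23⟩
      have hD : q₁ 1 - q₁ 0 ≠ 0 := (sub_pos.2 hq).ne'
      have hk : x i + x j = x k := by
        refine mul_right_cancel₀ hD ?_
        have e2 : q₁ 2 = q₁ 0 := by linarith
        have e3 : q₁ 3 = q₁ 1 := by linarith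
        rw [e2, e3] at h23
        rw [e3] at h03
        linarith
      refine ⟨⟨hk, hP⟩, fun c => ?_⟩
      fin_cases c <;> simp
      · linarith
      · constructor <;> linarith
      · have e3 : q₁ 3 = q₁ 1 := by linarith
        rw [e3, ← hk] at h03
        constructor <;> linarith
  · refine exists_gadget hne ![fun _ => 0, fun _ => 1, fun _ => 1, fun x => 1 - x j]
      ![fun _ => 0, fun x => x i * x j, fun x => x j, fun x => 0] ?_ ?_ (fun x => by simp)
      ![![.inl 0, .inr k, .inr j, .inl 0], ![.inl 0, .inl 0, .inl 1, .inr i],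
        ![.inl 0, .inl 0, .inl 0, .inl 2], ![.inl 0, .inl 0, .inl 0, .inl 0]] ?_ P
      (fun x h => h.2) ?_
    · intro c
      fin_cases c
      exacts [.const _, .const _, .const _, (PolyFn.const _).sub (.coord _)]
    · intro c
      fin_cases c
      exacts [.const _, (PolyFn.coord _).mul (.coord _), .coord _, .const _]
    · rw [forall_lt_fin_four]
      refine ⟨⟨1, fun x hx h => ⟨1, ?_⟩⟩, ⟨1, fun x hx h => ⟨1, ?_⟩⟩,
        ⟨-1, fun x hx h => ⟨1 - x j, ?_⟩⟩, ⟨-1, fun x hx h => ⟨x j - x i * x j, ?_⟩⟩,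
        ⟨-1, fun x hx h => ⟨-x j, ?_⟩⟩, ⟨-1, fun x hx h => ⟨-x j, ?_⟩⟩⟩ <;>
        have hi := hx.1 i <;> have hj := hx.1 j <;> have hj0 := zero_lt_one.trans hj <;>
        have hij : x j < x i * x j := lt_mul_of_one_lt_left hj0 hi <;>
        have hk := (ElemRel.holds_mul i j k x).1 h.1 <;>
        simp [dirX, dirY, hj, hj0, ← hk, hij, mul_comm (x j) (x i)]
    · intro x hx hP q₁ q₂ hq
      rw [forall_lt_fin_four]
      simp only [dirX, dirY, Matrix.cons_val, Sum.elim_inl, Sum.elim_inr, one_mul, zero_mul]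
      rintro ⟨h01, h02, h03, h12, h13, h23⟩
      have hD : q₁ 1 - q₁ 0 ≠ 0 := (sub_pos.2 hq).ne'
      have e2 : q₁ 2 = q₁ 1 := by linarith
      rw [e2] at h02 h23
      have e3 : q₁ 3 - q₁ 1 = -(x j * (q₁ 1 - q₁ 0)) := by linarith
      rw [e3] at h13
      have hk : x i * x j = x k := by
        refine mul_right_cancel₀ hD ?_
        linarith
      refine ⟨⟨hk, hP⟩, fun c => ?_⟩
      rw [← hk] at h01
      fin_cases c <;> simp
      · linarith
      · constructor <;> linarith
      · constructor <;> linarith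

theorem exists_configs_of_configs {κ : Type} [Fintype κ] {σ : κ → κ → SignType}
    (R : List (ElemRel κ)) {α : Type} [Fintype α] {χ₁ : Fin 3 ⊕ κ → α → α → SignType}
    {χ₂ : α → α → α → SignType} {o : α}
    (hne : (configs σ χ₁ χ₂ o (fun x => ∀ r ∈ R, r.Holds x)).Nonempty) :
    ∃ (β : Type) (_ : Fintype β) (χ₁' : Fin 3 ⊕ κ → β → β → SignType)
      (χ₂' : β → β → β → SignType) (o' : β),
      SE (configs σ χ₁ χ₂ o (fun x => ∀ r ∈ R, r.Holds x))
        (configs σ χ₁' χ₂' o' (fun _ => True)) ∧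
      (configs σ χ₁' χ₂' o' (fun _ => True)).Nonempty := by
  induction R generalizing α with
  | nil =>
    simp only [List.not_mem_nil, false_imp_iff, implies_true] at hne ⊢
    exact ⟨α, _, χ₁, χ₂, o, .refl _, hne⟩
  | cons r R ih =>
    simp only [List.forall_mem_cons] at hne ⊢
    obtain ⟨χ₁', χ₂', h1, h2⟩ := exists_gadget_of_elemRel r _ hne
    obtain ⟨β, hβ, χ₁'', χ₂'', o', h3, h4⟩ := ih h2
    exact ⟨β, hβ, χ₁'', χ₂'', o', h1.trans h3, h4⟩

/-- Solution sets of elementary relations are equivalent to spaces of configurations. -/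
theorem exists_configs {κ : Type} [Fintype κ] {σ : κ → κ → SignType} {R : List (ElemRel κ)}
    (hne : (orderedSolutions σ R (fun _ => True)).Nonempty) :
    ∃ (α : Type) (_ : Fintype α) (χ₁ : Fin 3 ⊕ κ → α → α → SignType)
      (χ₂ : α → α → α → SignType) (o : α),
      SE (orderedSolutions σ R (fun _ => True)) (configs σ χ₁ χ₂ o (fun _ => True)) ∧
      (configs σ χ₁ χ₂ o (fun _ => True)).Nonempty := by
  let T : Set (κ ⊕ (Unit ⊕ Unit) → ℝ) :=
    configs σ (fun _ _ _ => 0) (fun _ _ _ => 0) () (fun x => ∀ r ∈ R, r.Holds x)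
  let f : (κ → ℝ) → κ ⊕ (Unit ⊕ Unit) → ℝ := fun x => Sum.elim x (fun _ => 0)
  have hf : ∀ x ∈ orderedSolutions σ R (fun _ => True), f x ∈ T := fun x hx =>
    ⟨hx.1, hx.2.1, rfl, rfl, fun d a b => by simp [dirDet, f], fun a b c => by simp [orient, f]⟩
  have h1 : SE (orderedSolutions σ R (fun _ => True)) T := by
    refine .of_polynomial f (fun y i => y (.inl i)) ?_ (fun i => .coord _)
      (fun x hx => ⟨hf x hx, rfl⟩) (fun y hy => ⟨⟨hy.order, hy.pending, trivial⟩, ?_⟩)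
    · rintro (i | i)
      exacts [.coord _, .const _]
    · funext i
      rcases i with i | i | i
      exacts [rfl, hy.zeroX.symm, hy.zeroY.symm]
  obtain ⟨x, hx⟩ := hne
  obtain ⟨β, hβ, χ₁, χ₂, o, h2, h3⟩ := exists_configs_of_configs R ⟨_, hf x hx⟩
  exact ⟨β, hβ, χ₁, χ₂, o, h1.trans h2, h3⟩

/-! ### Configurations as realizations of chirotopes -/

theorem det3_swap₁₂ (u v w : Fin 3 → ℝ) : det3 v u w = -det3 u v w := by
  simp only [det3]
  ring

theorem det3_swap₂₃ (u v w : Fin 3 → ℝ) : det3 u w v = -det3 u v w := by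
  simp only [det3]
  ring

theorem sign_det3_scaled {m l₁ l₂ l₃ : ℝ} (hm : 0 < m) (h₁ : 0 < l₁) (h₂ : 0 < l₂) (h₃ : 0 < l₃)
    {u v w u' v' w' : Fin 3 → ℝ} (hu : ∀ c, u' c = l₁ * ![1, m, 1] c * u c)
    (hv : ∀ c, v' c = l₂ * ![1, m, 1] c * v c) (hw : ∀ c, w' c = l₃ * ![1, m, 1] c * w c) :
    sign (det3 u' v' w') = sign (det3 u v w) := by
  have h : det3 u' v' w' = (l₁ * l₂ * l₃ * m) * det3 u v w := by
    simp only [det3, hu, hv, hw, Matrix.cons_val]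
    ring
  rw [h, sign_mul, sign_pos (by positivity), one_mul]

/-- Homogeneous coordinates of the directions `(1, 0)`, `(0, 1)`, `(1, 1)`, `(1, x i)` and of the
points `(X a, Y a)`. -/
def homVec {κ α : Type} (x : κ → ℝ) (X Y : α → ℝ) : (Fin 3 ⊕ κ) ⊕ α → Fin 3 → ℝ :=
  Sum.elim (fun d => ![dirX d, dirY x d, 0]) (fun a => ![X a, Y a, 1])

section HomVec

variable {κ α : Type} (x : κ → ℝ) (X Y : α → ℝ)

theorem det3_homVec_dir_dir_dir (d e f : Fin 3 ⊕ κ) :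
    det3 (homVec x X Y (.inl d)) (homVec x X Y (.inl e)) (homVec x X Y (.inl f)) = 0 := by
  simp [det3, homVec]

theorem det3_homVec_dir_dir_point (d e : Fin 3 ⊕ κ) (a : α) :
    det3 (homVec x X Y (.inl d)) (homVec x X Y (.inl e)) (homVec x X Y (.inr a)) =
      dirX d * dirY x e - dirY x d * dirX e := by
  simp [det3, homVec]

theorem det3_homVec_dir_point_point (d : Fin 3 ⊕ κ) (a b : α) :
    det3 (homVec x X Y (.inl d)) (homVec x X Y (.inr b)) (homVec x X Y (.inr a)) =
      dirDet x X Y d a b := by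
  simp [det3, homVec, dirDet]

theorem det3_homVec_point_point_point (a b c : α) :
    det3 (homVec x X Y (.inr a)) (homVec x X Y (.inr b)) (homVec x X Y (.inr c)) =
      orient X Y a b c := by
  simp only [det3, homVec, orient, Sum.elim_inr, Matrix.cons_val]
  ring

end HomVec

theorem IsConfig.sign_det3_homVec {κ α : Type} {σ : κ → κ → SignType}
    {χ₁ : Fin 3 ⊕ κ → α → α → SignType} {χ₂ : α → α → α → SignType} {o : α}
    {P : (κ → ℝ) → Prop} {x x' : κ → ℝ} {X Y X' Y' : α → ℝ} (h : IsConfig σ χ₁ χ₂ o P x X Y)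
    (h' : IsConfig σ χ₁ χ₂ o P x' X' Y') (i j k : (Fin 3 ⊕ κ) ⊕ α) :
    sign (det3 (homVec x X Y i) (homVec x X Y j) (homVec x X Y k)) =
      sign (det3 (homVec x' X' Y' i) (homVec x' X' Y' j) (homVec x' X' Y' k)) := by
  let Q : (Fin 3 ⊕ κ) ⊕ α → (Fin 3 ⊕ κ) ⊕ α → (Fin 3 ⊕ κ) ⊕ α → Prop := fun i j k =>
    sign (det3 (homVec x X Y i) (homVec x X Y j) (homVec x X Y k)) =
      sign (det3 (homVec x' X' Y' i) (homVec x' X' Y' j) (homVec x' X' Y' k))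
  have swap₁ : ∀ {i j k}, Q i j k → Q j i k := fun {i j k} h => by
    simp only [Q] at h ⊢
    rw [det3_swap₁₂, Left.sign_neg, h, ← Left.sign_neg, ← det3_swap₁₂]
  have swap₂ : ∀ {i j k}, Q i j k → Q i k j := fun {i j k} h => by
    simp only [Q] at h ⊢
    rw [det3_swap₂₃, Left.sign_neg, h, ← Left.sign_neg, ← det3_swap₂₃]
  have ddp : ∀ d e a, Q (.inl d) (.inl e) (.inr a) := fun d e a => by
    obtain ⟨s, hs⟩ := exists_sign_dir_det σ d e
    simp only [Q, det3_homVec_dir_dir_point]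
    rw [hs _ h.order, hs _ h'.order]
  have dpp : ∀ d a b, Q (.inl d) (.inr a) (.inr b) := fun d a b => by
    simp only [Q, det3_homVec_dir_point_point]
    rw [h.sign_dirDet, h'.sign_dirDet]
  change Q i j k
  rcases i with i | i <;> rcases j with j | j <;> rcases k with k | k
  · simp only [Q, det3_homVec_dir_dir_dir]
  · exact ddp i j k
  · exact swap₂ (ddp i k j)
  · exact dpp i j k
  · exact swap₁ (swap₂ (ddp j k i))
  · exact swap₁ (dpp j i k)
  · exact swap₂ (swap₁ (dpp k i j))
  · simp only [Q, det3_homVec_point_point_point]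
    rw [h.sign_orient, h'.sign_orient]

theorem IsConfig.of_sign_det3_homVec {κ α : Type} {σ : κ → κ → SignType}
    {χ₁ : Fin 3 ⊕ κ → α → α → SignType} {χ₂ : α → α → α → SignType} {o : α}
    {x x' : κ → ℝ} {X Y X' Y' : α → ℝ} (h' : IsConfig σ χ₁ χ₂ o (fun _ => True) x' X' Y')
    (hX : X o = 0) (hY : Y o = 0)
    (h : ∀ i j k, sign (det3 (homVec x X Y i) (homVec x X Y j) (homVec x X Y k)) =
      sign (det3 (homVec x' X' Y' i) (homVec x' X' Y' j) (homVec x' X' Y' k))) :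
    IsConfig σ χ₁ χ₂ o (fun _ => True) x X Y := by
  refine ⟨⟨fun i => ?_, fun i j => ?_⟩, trivial, hX, hY, fun d a b => ?_, fun a b c => ?_⟩
  · have h1 := h (.inl (.inl 2)) (.inl (.inr i)) (.inr o)
    simp only [det3_homVec_dir_dir_point] at h1
    have h2 := h'.order.1 i
    have h3 := sign_eq_one_iff.1 (h1.trans (sign_pos (by simpa [dirX, dirY] using h2)))
    simpa [dirX, dirY] using h3
  · have h1 := h (.inl (.inr j)) (.inl (.inr i)) (.inr o)
    simp only [det3_homVec_dir_dir_point] at h1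
    rw [← h'.order.2 i j]
    simpa [dirX, dirY] using h1
  · have h1 := h (.inl d) (.inr b) (.inr a)
    simp only [det3_homVec_dir_point_point] at h1
    rw [h1, h'.sign_dirDet]
  · have h1 := h (.inr a) (.inr b) (.inr c)
    simp only [det3_homVec_point_point_point] at h1
    rw [h1, h'.sign_orient]

/-- Normalized vector configurations with prescribed orientations, as a set of coordinate
vectors. -/
def realizations {J : Type} (χ : Fin 3 ⊕ J → Fin 3 ⊕ J → Fin 3 ⊕ J → SignType) :
    Set ((Fin 3 ⊕ J) × Fin 3 → ℝ) :=
  {w | (∀ b c, w (.inl b, c) = if b = c then 1 else 0) ∧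
    ∀ i j k, sign (det3 (fun c => w (i, c)) (fun c => w (j, c)) (fun c => w (k, c))) = χ i j k}

/-- Directions and points represented by the basis vectors, by a further vector, and by the
vectors for the slopes and the points of a configuration. -/
def vecKind {κ α : Type} (o : α) : Fin 3 ⊕ (Unit ⊕ (κ ⊕ α)) → (Fin 3 ⊕ κ) ⊕ α :=
  Sum.elim ![.inl (.inl 0), .inl (.inl 1), .inr o]
    (Sum.elim (fun _ => .inl (.inl 2)) (Sum.elim (fun i => .inl (.inr i)) .inr))

theorem vecKind_surjective {κ α : Type} (o : α) :
    Function.Surjective (vecKind (κ := κ) o) := by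
  rintro ((d | i) | a)
  · fin_cases d
    exacts [⟨.inl 0, rfl⟩, ⟨.inl 1, rfl⟩, ⟨.inr (.inl ()), rfl⟩]
  · exact ⟨.inr (.inr (.inl i)), rfl⟩
  · exact ⟨.inr (.inr (.inr a)), rfl⟩

theorem realizations_apply {J : Type} {χ : Fin 3 ⊕ J → Fin 3 ⊕ J → Fin 3 ⊕ J → SignType}
    {w : (Fin 3 ⊕ J) × Fin 3 → ℝ} (hw : w ∈ realizations χ) (j : Fin 3 ⊕ J) :
    sign (w (j, 0)) = χ j (.inl 1) (.inl 2) ∧ sign (w (j, 1)) = χ (.inl 0) j (.inl 2) ∧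
      sign (w (j, 2)) = χ (.inl 0) (.inl 1) j := by
  obtain ⟨h1, h2⟩ := hw
  simp [← h2, det3, h1]

/-- Spaces of configurations are equivalent to spaces of realizations. -/
theorem exists_realizations {κ α : Type} [Fintype κ] [Fintype α] {σ : κ → κ → SignType}
    {χ₁ : Fin 3 ⊕ κ → α → α → SignType} {χ₂ : α → α → α → SignType} {o : α}
    (hne : (configs σ χ₁ χ₂ o (fun _ => True)).Nonempty) :
    ∃ (J : Type) (_ : Fintype J) (χ : Fin 3 ⊕ J → Fin 3 ⊕ J → Fin 3 ⊕ J → SignType),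
      SE (configs σ χ₁ χ₂ o (fun _ => True)) (realizations χ) ∧ (realizations χ).Nonempty := by
  obtain ⟨y₀, hy₀⟩ := hne
  let J := Unit ⊕ (κ ⊕ α)
  let I := Fin 3 ⊕ J
  let C := configs σ χ₁ χ₂ o (fun _ => True)
  let vec : (κ ⊕ (α ⊕ α) → ℝ) → (Fin 3 ⊕ κ) ⊕ α → Fin 3 → ℝ := fun y =>
    homVec (fun i => y (.inl i)) (fun a => y (.inr (.inl a))) (fun a => y (.inr (.inr a)))
  let χ : I → I → I → SignType := fun i j k =>
    sign (det3 (vec y₀ (vecKind o i)) (vec y₀ (vecKind o j)) (vec y₀ (vecKind o k)))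
  let C' : Set ((κ ⊕ (α ⊕ α)) ⊕ (Unit ⊕ J) → ℝ) :=
    {w | (fun i => w (.inl i)) ∈ C ∧ ∀ k, sign (w (.inr k)) = 1}
  have hC' : SE C C' := .of_affine C (fun k _ u => u k) (fun k => .coord k) (fun _ => 1)
    (fun _ _ => ⟨1, fun _ => by simp⟩)
  let y : ((κ ⊕ (α ⊕ α)) ⊕ (Unit ⊕ J) → ℝ) → κ ⊕ (α ⊕ α) → ℝ := fun w i => w (.inl i)
  let m : ((κ ⊕ (α ⊕ α)) ⊕ (Unit ⊕ J) → ℝ) → ℝ := fun w => w (.inr (.inl ()))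
  let l : ((κ ⊕ (α ⊕ α)) ⊕ (Unit ⊕ J) → ℝ) → J → ℝ := fun w j => w (.inr (.inr j))
  let f : ((κ ⊕ (α ⊕ α)) ⊕ (Unit ⊕ J) → ℝ) → I × Fin 3 → ℝ := fun w p =>
    Sum.elim (fun b c => if b = c then 1 else 0)
      (fun j c => l w j * ![1, m w, 1] c * vec (y w) (vecKind o (.inr j)) c) p.1 p.2
  let one : I := .inr (.inl ())
  let slope : κ → I := fun i => .inr (.inr (.inl i))
  let point : α → I := fun a => .inr (.inr (.inr a))
  let g : (I × Fin 3 → ℝ) → (κ ⊕ (α ⊕ α)) ⊕ (Unit ⊕ J) → ℝ := fun v =>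
    Sum.elim (Sum.elim (fun i => v (slope i, 1) * v (one, 0) / (v (slope i, 0) * v (one, 1)))
      (Sum.elim (fun a => v (point a, 0) / v (point a, 2))
        (fun a => v (point a, 1) * v (one, 0) / (v (point a, 2) * v (one, 1)))))
      (Sum.elim (fun _ => v (one, 1) / v (one, 0))
        (Sum.elim (fun _ => v (one, 0)) (Sum.elim (fun i => v (slope i, 0))
          (fun a => v (point a, 2)))))
  have hpoly : ∀ p, PolyFn (fun w => f w p) := by
    rintro ⟨b | j, c⟩
    · exact .const _
    · have h1 : PolyFn (fun w : (κ ⊕ (α ⊕ α)) ⊕ (Unit ⊕ J) → ℝ =>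
          (![1, m w, 1] : Fin 3 → ℝ) c) := by
        fin_cases c
        exacts [.const _, .coord _, .const _]
      refine ((PolyFn.coord _).mul h1).mul ?_
      rcases j with j | j | j <;> fin_cases c <;> first | exact .coord _ | exact .const _
  have scaled : ∀ w, vec (y w) (.inr o) = ![0, 0, 1] → 0 < m w → (∀ j, 0 < l w j) → ∀ i, ∃ r,
      0 < r ∧ ∀ c, f w (i, c) = r * ![1, m w, 1] c * vec (y w) (vecKind o i) c := by
    rintro w hw hm hl (b | j)
    · fin_cases b
      · exact ⟨1, one_pos, fun c => by
          fin_cases c <;> simp [f, vec, homVec, vecKind, dirX, dirY]⟩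
      · exact ⟨1 / m w, by positivity, fun c => by
          fin_cases c <;> simp [f, vec, homVec, vecKind, dirX, dirY, hm.ne']⟩
      · refine ⟨1, one_pos, fun c => ?_⟩
        rw [show vecKind (κ := κ) o (.inl ⟨2, by simp⟩) = .inr o from rfl, hw]
        fin_cases c <;> simp [f]
    · exact ⟨l w j, hl j, fun c => rfl⟩
  have hf : ∀ w ∈ C', f w ∈ realizations χ := by
    rintro w ⟨hw, hk⟩
    refine ⟨fun b c => rfl, fun i j k => ?_⟩
    have h := scaled w (by simp [vec, homVec, y, hw.zeroX, hw.zeroY])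
      (sign_eq_one_iff.1 (hk _)) (fun j => sign_eq_one_iff.1 (hk _))
    obtain ⟨r₁, hr₁, h₁⟩ := h i
    obtain ⟨r₂, hr₂, h₂⟩ := h j
    obtain ⟨r₃, hr₃, h₃⟩ := h k
    exact (sign_det3_scaled (sign_eq_one_iff.1 (hk _)) hr₁ hr₂ hr₃ h₁ h₂ h₃).trans
      (hw.sign_det3_homVec hy₀ _ _ _)
  have hχ : ∀ v ∈ realizations χ, ∀ j, sign (v (j, 0)) = sign (vec y₀ (vecKind o j) 0) ∧
      sign (v (j, 1)) = sign (vec y₀ (vecKind o j) 1) ∧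
      sign (v (j, 2)) = sign (vec y₀ (vecKind o j) 2) := by
    intro v hv j
    have h1 := hy₀.zeroX
    have h2 := hy₀.zeroY
    obtain ⟨h3, h4, h5⟩ := realizations_apply hv j
    refine ⟨h3.trans ?_, h4.trans ?_, h5.trans ?_⟩ <;>
      simp [χ, det3, vecKind, vec, homVec, dirX, dirY, h1, h2]
  have one0 : ∀ v ∈ realizations χ, 0 < v (one, 0) := fun v hv => by
    rw [← sign_eq_one_iff, (hχ v hv _).1]
    simp [one, vecKind, vec, homVec, dirX]
  have one1 : ∀ v ∈ realizations χ, 0 < v (one, 1) := fun v hv => by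
    rw [← sign_eq_one_iff, (hχ v hv _).2.1]
    simp [one, vecKind, vec, homVec, dirY]
  have slope0 : ∀ v ∈ realizations χ, ∀ i, 0 < v (slope i, 0) := fun v hv i => by
    rw [← sign_eq_one_iff, (hχ v hv _).1]
    simp [slope, vecKind, vec, homVec, dirX]
  have point2 : ∀ v ∈ realizations χ, ∀ a, 0 < v (point a, 2) := fun v hv a => by
    rw [← sign_eq_one_iff, (hχ v hv _).2.2]
    simp [point, vecKind, vec, homVec]
  have hrat : ∀ i, RatFnOn (realizations χ) (fun v => g v i) := by
    have co : ∀ p, PolyFn (fun v : I × Fin 3 → ℝ => v p) := .coord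
    rintro ((i | a | a) | _ | _ | i | a)
    · exact (((co _).mul (co _)).ratFnOn _).div (((co _).mul (co _)).ratFnOn _)
        fun v hv => (mul_pos (slope0 v hv i) (one1 v hv)).ne'
    · exact ((co _).ratFnOn _).div ((co _).ratFnOn _) fun v hv => (point2 v hv a).ne'
    · exact (((co _).mul (co _)).ratFnOn _).div (((co _).mul (co _)).ratFnOn _)
        fun v hv => (mul_pos (point2 v hv a) (one1 v hv)).ne'
    · exact ((co _).ratFnOn _).div ((co _).ratFnOn _) fun v hv => (one0 v hv).ne'
    · exact (co _).ratFnOn _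
    · exact (co _).ratFnOn _
    · exact (co _).ratFnOn _
  have hg : ∀ v ∈ realizations χ, g v ∈ C' ∧ f (g v) = v := by
    intro v hv
    have h := hχ v hv
    have one0 := one0 v hv
    have one1 := one1 v hv
    have slope0 := slope0 v hv
    have point2 := point2 v hv
    have one2 : v (one, 2) = 0 := by
      rw [← sign_eq_zero_iff, (h _).2.2]
      simp [one, vecKind, vec, homVec]
    have slope2 : ∀ i, v (slope i, 2) = 0 := fun i => by
      rw [← sign_eq_zero_iff, (h _).2.2]
      simp [slope, vecKind, vec, homVec]
    have o0 : v (point o, 0) = 0 := by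
      rw [← sign_eq_zero_iff, (h _).1]
      simp [point, vecKind, vec, homVec, hy₀.zeroX]
    have o1 : v (point o, 1) = 0 := by
      rw [← sign_eq_zero_iff, (h _).2.1]
      simp [point, vecKind, vec, homVec, hy₀.zeroY]
    have fg : f (g v) = v := by
      funext p
      rcases p with ⟨b | _ | i | a, c⟩
      · exact (hv.1 b c).symm
      · fin_cases c
        · simp [f, g, l, m, vec, vecKind, homVec, dirX, dirY, one]
        · simp [f, g, l, m, vec, vecKind, homVec, dirX, dirY]
          field_simp
          rfl
        · simpa [f, g, l, m, vec, vecKind, homVec, dirX, dirY] using one2.symm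
      · have := slope0 i
        fin_cases c
        · simp [f, g, l, m, vec, vecKind, homVec, dirX, dirY, slope]
        · simp [f, g, l, m, vec, vecKind, homVec, dirX, dirY, y]
          field_simp
          rfl
        · simpa [f, g, l, m, vec, vecKind, homVec, dirX, dirY] using (slope2 i).symm
      · have := point2 a
        fin_cases c
        · simp [f, g, l, m, vec, vecKind, homVec, y]
          field_simp
          rfl
        · simp [f, g, l, m, vec, vecKind, homVec, y]
          field_simp
          rfl
        · simp [f, g, l, m, vec, vecKind, homVec, point]
    have hm : 0 < m (g v) := div_pos one1 one0
    have hl : ∀ j, 0 < l (g v) j := by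
      rintro (_ | i | a)
      exacts [one0, slope0 i, point2 a]
    have go0 : y (g v) (.inr (.inl o)) = 0 := by simp [y, g, o0]
    have go1 : y (g v) (.inr (.inr o)) = 0 := by simp [y, g, o1]
    refine ⟨⟨?_, ?_⟩, fg⟩
    · refine hy₀.of_sign_det3_homVec go0 go1 ?_
      refine (vecKind_surjective o).forall₃.2 fun i j k => ?_
      have h := scaled (g v) (by simp [vec, homVec, go0, go1]) hm hl
      rw [fg] at h
      obtain ⟨r₁, hr₁, h₁⟩ := h i
      obtain ⟨r₂, hr₂, h₂⟩ := h j
      obtain ⟨r₃, hr₃, h₃⟩ := h k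
      exact (sign_det3_scaled hm hr₁ hr₂ hr₃ h₁ h₂ h₃).symm.trans (hv.2 i j k)
    · rintro (_ | j)
      exacts [sign_pos hm, sign_pos (hl j)]
  have gf : ∀ w ∈ C', g (f w) = w := by
    rintro w ⟨hw, hk⟩
    have hm : w (.inr (.inl ())) ≠ 0 := (sign_eq_one_iff.1 (hk (.inl ()))).ne'
    have hl : ∀ j, w (.inr (.inr j)) ≠ 0 := fun j => (sign_eq_one_iff.1 (hk (.inr j))).ne'
    funext p
    rcases p with (i | a | a) | _ | _ | i | a
    · have h1 := hl (.inl ())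
      have h2 := hl (.inr (.inl i))
      simp [f, g, l, m, vec, vecKind, homVec, dirX, dirY, y, one, slope]
      field_simp
    · have h1 := hl (.inr (.inr a))
      simp [f, g, l, m, vec, vecKind, homVec, y, point]
      field_simp
    · have h1 := hl (.inl ())
      have h2 := hl (.inr (.inr a))
      simp [f, g, l, m, vec, vecKind, homVec, dirX, dirY, y, one, point]
      field_simp
    · have h1 := hl (.inl ())
      simp [f, g, l, m, vec, vecKind, homVec, dirX, dirY, one]
      field_simp
    · simp [f, g, l, m, vec, vecKind, homVec, dirX, one]
    · simp [f, g, l, m, vec, vecKind, homVec, dirX, slope]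
    · simp [f, g, l, m, vec, vecKind, homVec, point]
  refine ⟨J, inferInstance, χ, hC'.trans (.of_rational f g (fun p => (hpoly p).ratFnOn _) hrat
    (fun w hw => ⟨hf w hw, gf w hw⟩) hg), _, hf (Sum.elim y₀ 1) ⟨hy₀, fun k => ?_⟩⟩
  simp

theorem real_sign_eq_iff (a b : ℝ) : Real.sign a = Real.sign b ↔ sign a = sign b := by
  rcases lt_trichotomy a 0 with ha | rfl | ha <;> rcases lt_trichotomy b 0 with hb | rfl | hb <;>
    simp [*, Real.sign_of_neg, Real.sign_of_pos] <;> norm_num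

theorem stablyEquivalent_toFin {d : ℕ} (S : Set (Fin d → ℝ)) :
    StablyEquivalent ⟨d, S⟩ (toFin S) :=
  .rel _ _ (.inr (SE.rationallyEquivalent_of_equiv (.refl (Fin d)) (Fintype.equivFin _)
    (S := S) (T := S) id id (fun k => (PolyFn.coord k).ratFnOn S)
    (fun k => (PolyFn.coord k).ratFnOn S) (fun _ hx => ⟨hx, rfl⟩) (fun _ hx => ⟨hx, rfl⟩)))

theorem IsStableProjection.nonempty_iff {d d' : ℕ} {S : Set (Fin d → ℝ)}
    {T : Set (Fin (d + d') → ℝ)} (h : IsStableProjection S T) : S.Nonempty ↔ T.Nonempty := by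
  obtain ⟨k, l, A, b, C, c, h1, h2⟩ := h
  constructor
  · rintro ⟨x, hx⟩
    obtain ⟨y, hy⟩ := h1 x hx
    exact ⟨_, hy⟩
  · rintro ⟨z, hz⟩
    rw [← Fin.append_castAdd_natAdd (f := z), h2] at hz
    exact ⟨_, hz.1⟩

theorem StablyEquivalent.nonempty_iff {X Y : Σ d : ℕ, Set (Fin d → ℝ)}
    (h : StablyEquivalent X Y) : X.2.Nonempty ↔ Y.2.Nonempty := by
  induction h with
  | rel X Y h =>
    rcases h with ⟨d', T, rfl, h⟩ | ⟨f, g, -, -, hf, hg, -⟩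
    · exact h.nonempty_iff
    · exact ⟨fun ⟨x, hx⟩ => ⟨_, hf x hx⟩, fun ⟨y, hy⟩ => ⟨_, hg y hy⟩⟩
  | refl => rfl
  | symm _ _ _ ih => exact ih.symm
  | trans _ _ _ _ _ ih ih' => exact ih.trans ih'

theorem toFin_nonempty_iff {ι : Type} [Fintype ι] (S : Set (ι → ℝ)) :
    (toFin S).2.Nonempty ↔ S.Nonempty := by
  refine ⟨fun ⟨x, hx⟩ => ⟨_, hx⟩, fun ⟨x, hx⟩ => ⟨fun i => x ((Fintype.equivFin ι).symm i), ?_⟩⟩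
  change (fun i => x ((Fintype.equivFin ι).symm (Fintype.equivFin ι i))) ∈ S
  simpa using hx

/-- Nonempty primary basic semialgebraic sets over `ℤ` are equivalent to spaces of
realizations. -/
theorem IsPrimaryBasicSemialgebraicZ.exists_realizations {m : ℕ} {V : Set (Fin m → ℝ)}
    (hV : IsPrimaryBasicSemialgebraicZ V) (hne : V.Nonempty) :
    ∃ (J : Type) (_ : Fintype J) (χ : Fin 3 ⊕ J → Fin 3 ⊕ J → Fin 3 ⊕ J → SignType),
      SE V (realizations χ) ∧ (realizations χ).Nonempty := by
  obtain ⟨κ, _, L, h1⟩ := hV.exists_posSolutions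
  have h2 : (posSolutions L).Nonempty := by
    rwa [← toFin_nonempty_iff, ← StablyEquivalent.nonempty_iff h1, toFin_nonempty_iff]
  obtain ⟨τ, _, σ, R, h3, h4⟩ := exists_orderedSolutions L h2
  obtain ⟨α, _, χ₁, χ₂, o, h5, h6⟩ := exists_configs h4
  obtain ⟨J, _, χ, h7, h8⟩ := _root_.exists_realizations h6
  exact ⟨J, _, χ, ((h1.trans h3).trans h5).trans h7, h8⟩

/-- Flattening as a bijection of index types. -/
def flatEquiv (n d : ℕ) : Fin n × Fin d ≃ Fin (d * n) :=
  finProdFinEquiv.trans (finCongr (Nat.mul_comm n d))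

theorem flatEquiv_apply {n d : ℕ} (p : Fin n) (c : Fin d) : flatEquiv n d (p, c) = flatIdx p c := by
  apply Fin.ext
  simp [flatEquiv, flatIdx, add_comm]

theorem exists_chirotope_of_realizations {J : Type} [Fintype J]
    {χ : Fin 3 ⊕ J → Fin 3 ⊕ J → Fin 3 ⊕ J → SignType} (hne : (realizations χ).Nonempty) :
    ∃ (n : ℕ) (hn : 3 ≤ n) (χ' : Fin n → Fin n → Fin n → ℝ), IsRealizableChirotope χ' ∧
      χ' ⟨0, by omega⟩ ⟨1, by omega⟩ ⟨2, by omega⟩ = 1 ∧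
      SE (realizations χ) (flat (chirotopeRealizationSpace hn χ')) := by
  obtain ⟨w₀, hw₀⟩ := hne
  let n := 3 + Fintype.card J
  have hn : 3 ≤ n := Nat.le_add_right _ _
  let e : Fin 3 ⊕ J ≃ Fin n := ((Equiv.refl (Fin 3)).sumCongr (Fintype.equivFin J)).trans
    finSumFinEquiv
  let ε : (Fin 3 ⊕ J) × Fin 3 ≃ Fin (3 * n) :=
    (e.prodCongr (Equiv.refl (Fin 3))).trans (flatEquiv n 3)
  have hε : ∀ j c, ε (j, c) = flatIdx (e j) c := fun j c => flatEquiv_apply _ _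
  let v₀ : Fin n → Fin 3 → ℝ := fun p c => w₀ (e.symm p, c)
  let χ' : Fin n → Fin n → Fin n → ℝ := fun i j k => Real.sign (det3 (v₀ i) (v₀ j) (v₀ k))
  have e0 : (⟨0, by omega⟩ : Fin n) = e (.inl 0) := rfl
  have e1 : (⟨1, by omega⟩ : Fin n) = e (.inl 1) := rfl
  have e2 : (⟨2, by omega⟩ : Fin n) = e (.inl 2) := rfl
  have h1 : χ' ⟨0, by omega⟩ ⟨1, by omega⟩ ⟨2, by omega⟩ = 1 := by
    simp [χ', v₀, e0, e1, e2, det3, hw₀.1]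
  have hmem : ∀ v : Fin n → Fin 3 → ℝ, v ∈ chirotopeRealizationSpace hn χ' ↔
      (fun p : (Fin 3 ⊕ J) × Fin 3 => v (e p.1) p.2) ∈ realizations χ := by
    intro v
    have h2 : (∀ i j k, Real.sign (det3 (v i) (v j) (v k)) = χ' i j k) ↔
        ∀ i j k, sign (det3 (v (e i)) (v (e j)) (v (e k))) = χ i j k := by
      simp only [χ', real_sign_eq_iff, ← e.forall_congr_right (q := fun i => ∀ j k,
        sign (det3 (v i) (v j) (v k)) = sign (det3 (v₀ i) (v₀ j) (v₀ k)))]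
      refine forall_congr' fun i => ?_
      rw [← e.forall_congr_right]
      refine forall_congr' fun j => ?_
      rw [← e.forall_congr_right]
      refine forall_congr' fun k => ?_
      rw [← hw₀.2 i j k]
      simp [v₀]
    have h3 : (∀ b c, v (e (.inl b)) c = if b = c then 1 else 0) ↔
        v (e (.inl 0)) = ![1, 0, 0] ∧ v (e (.inl 1)) = ![0, 1, 0] ∧
          v (e (.inl 2)) = ![0, 0, 1] := by
      simp [Fin.forall_fin_succ, funext_iff]
    change (_ ∧ _ ∧ _ ∧ ∀ i j k, _) ↔ ((∀ b c, _) ∧ ∀ i j k, _)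
    rw [h2, h3, e0, e1, e2]
    simp only [and_assoc]
  refine ⟨n, hn, χ', ⟨fun i j k => ⟨?_, ?_⟩, fun i j k => ?_,
    ⟨_, _, _, by rw [h1]; exact one_ne_zero⟩,
    v₀, fun i j k => rfl⟩, h1, ?_⟩
  · simp only [χ']
    rw [det3_swap₁₂, Real.sign_neg]
  · simp only [χ']
    rw [det3_swap₂₃, Real.sign_neg]
  · rcases Real.sign_apply_eq (det3 (v₀ i) (v₀ j) (v₀ k)) with h | h | h <;> simp [χ', h]
  · refine .of_polynomial (fun w q => w (ε.symm q)) (fun z p => z (ε p)) (fun k => .coord _)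
      (fun i => .coord _) (fun w hw => ⟨?_, by simp⟩) (fun z hz => ⟨?_, by simp⟩)
    · change (fun p c => w (ε.symm (flatIdx p c))) ∈ chirotopeRealizationSpace hn χ'
      rw [hmem]
      simpa [← hε] using hw
    · have h2 : (fun p c => z (flatIdx p c)) ∈ chirotopeRealizationSpace hn χ' := hz
      rw [hmem] at h2
      simpa [← hε] using h2

/-- **Universality for oriented matroids of rank 3** (Theorem 1.1(i)).
Every nonempty primary basic semialgebraic set defined over `ℤ` is stably equivalent to the
realization space of a realizable rank-3 chirotope. -/
theorem universality_rank3_chirotopes (m : ℕ) (V : Set (Fin m → ℝ))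
    (hV : IsPrimaryBasicSemialgebraicZ V) (hVne : V.Nonempty) :
    ∃ (n : ℕ) (hn : 3 ≤ n) (χ : Fin n → Fin n → Fin n → ℝ),
      IsRealizableChirotope χ ∧
      χ ⟨0, by omega⟩ ⟨1, by omega⟩ ⟨2, by omega⟩ = 1 ∧
      StablyEquivalent ⟨m, V⟩ ⟨3 * n, flat (chirotopeRealizationSpace hn χ)⟩ := by
  obtain ⟨J, _, χ, h1, h2⟩ := hV.exists_realizations hVne
  obtain ⟨n, hn, χ', h3, h4, h5⟩ := exists_chirotope_of_realizations h2
  exact ⟨n, hn, χ', h3, h4, ((stablyEquivalent_toFin V).trans _ _ _ (h1.trans h5)).trans _ _ _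
    (.symm _ _ (stablyEquivalent_toFin _))⟩
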